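/- There exist R ∈ ℕ and a constant B ≥ 1 with the following property. Let m ∈ ℕ, let k ∈ ℕ with 0 ≤ k ≤ m−1, let p ∈ Γ with |p| = 3Rm, and let α ∈ [p,e] be a geodesic segment. If u and v are functions on Γ which are positive and harmonic on C_{3Rk}(p) and vanish at infinity on C_{3Rk}(p), then u(g)/u(α(3Rk+2R)) ≤ B · v(g)/v(α(3Rk+2R)) for all g ∈ C_{3R(k+1)}(p). (A Harnack inequality at infinity.) -/

import Mathlib

open Filter Topology MeasureTheory
open scoped ENNReal

namespace HarmonicBoundary

variable {Γ : Type} [Group Γ]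

/-- Word length of `g` with respect to a generating set `S`. -/
noncomputable def wl (S : Set Γ) (g : Γ) : ℕ :=
  sInf {n : ℕ | ∃ w : List Γ, w.length = n ∧ (∀ x ∈ w, x ∈ S) ∧ w.prod = g}

/-- Word metric `d(x,y) = |x⁻¹y|`. -/
noncomputable def wdist (S : Set Γ) (x y : Γ) : ℕ := wl S (x⁻¹ * y)

/-- Gromov product `(x|y)_z = (d(x,z)+d(y,z)-d(x,y))/2`. -/
noncomputable def gp (S : Set Γ) (z x y : Γ) : ℝ :=
  ((wdist S x z : ℝ) + (wdist S y z : ℝ) - (wdist S x y : ℝ)) / 2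

/-- `S` is a finite symmetric generating set of `Γ`. -/
def IsGenSet (S : Set Γ) : Prop :=
  S.Finite ∧ (∀ s ∈ S, s⁻¹ ∈ S) ∧ Subgroup.closure S = ⊤

/-- `Γ` is `δ`-hyperbolic with respect to the word metric of `S`:
`(x|y) ≥ min ((x|z), (y|z)) - δ` for all `x y z`. -/
def IsHyperbolic (S : Set Γ) (δ : ℝ) : Prop :=
  0 ≤ δ ∧ ∀ x y z : Γ, min (gp S 1 x z) (gp S 1 y z) - δ ≤ gp S 1 x y

/-- `Γ` is nonelementary: it has no cyclic subgroup of finite index. -/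
def Nonelementary (Γ : Type) [Group Γ] : Prop :=
  ∀ g : Γ, (Subgroup.zpowers g).index = 0

/-- A sequence converges to infinity if `(x_i|x_j) → ∞`. -/
def ConvInf (S : Set Γ) (u : ℕ → Γ) : Prop :=
  Tendsto (fun p : ℕ × ℕ => gp S 1 (u p.1) (u p.2)) atTop atTop

/-- Two sequences converging to infinity are equivalent if `(x_i|y_j) → ∞`. -/
def EquivSeq (S : Set Γ) (u v : ℕ → Γ) : Prop :=
  Tendsto (fun p : ℕ × ℕ => gp S 1 (u p.1) (v p.2)) atTop atTop

/-- An (abstract model of the) Gromov boundary of `Γ`: the points are exactly the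
classes of sequences converging to infinity, modulo the equivalence `EquivSeq`,
together with the natural left action of `Γ`. -/
structure Boundary (Γ : Type) [Group Γ] (S : Set Γ) where
  pt : Type
  cls : (ℕ → Γ) → pt
  cls_surj : ∀ ξ : pt, ∃ u : ℕ → Γ, ConvInf S u ∧ cls u = ξ
  cls_eq : ∀ u v : ℕ → Γ, ConvInf S u → ConvInf S v → (cls u = cls v ↔ EquivSeq S u v)
  smul : Γ → pt → pt
  smul_cls : ∀ (g : Γ) (u : ℕ → Γ), ConvInf S u → smul g (cls u) = cls fun n => g * u n

/-- Extension of the Gromov product to the boundary: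
`(ξ|η) = sup liminf (x_i|y_j)` over sequences representing `ξ` and `η`,
as an extended nonnegative real. -/
noncomputable def bgp {S : Set Γ} (B : Boundary Γ S) (ξ η : B.pt) : ℝ≥0∞ :=
  ⨆ (u : {u : ℕ → Γ // ConvInf S u ∧ B.cls u = ξ})
    (v : {v : ℕ → Γ // ConvInf S v ∧ B.cls v = η}),
    Filter.liminf (fun p : ℕ × ℕ => ENNReal.ofReal (gp S 1 (u.1 p.1) (v.1 p.2))) atTop

/-- Real-valued Gromov product on the boundary (finite for `ξ ≠ η`). -/
noncomputable def bgpR {S : Set Γ} (B : Boundary Γ S) (ξ η : B.pt) : ℝ := (bgp B ξ η).toReal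

/-- The canonical topology of the Gromov boundary: a set is open iff around each of
its points it contains a basic neighbourhood `V_r(p) = {q | (q|p) > r}`. -/
def btop {S : Set Γ} (B : Boundary Γ S) : TopologicalSpace B.pt where
  IsOpen O := ∀ p ∈ O, ∃ r : ℝ≥0∞, r ≠ ⊤ ∧ {q | r < bgp B q p} ⊆ O
  isOpen_univ := fun p _ => ⟨0, ENNReal.zero_ne_top, fun q _ => trivial⟩
  isOpen_inter := by
    intro A A' hA hA' p hp
    obtain ⟨r1, hr1, h1⟩ := hA p hp.1
    obtain ⟨r2, hr2, h2⟩ := hA' p hp.2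
    refine ⟨max r1 r2, (max_lt hr1.lt_top hr2.lt_top).ne, fun q hq => ?_⟩
    have hq' : max r1 r2 < bgp B q p := hq
    exact ⟨h1 (show r1 < bgp B q p from (le_max_left r1 r2).trans_lt hq'),
      h2 (show r2 < bgp B q p from (le_max_right r1 r2).trans_lt hq')⟩
  isOpen_sUnion := by
    intro s hs p hp
    obtain ⟨t, ht, hpt⟩ := hp
    obtain ⟨r, hr, hsub⟩ := hs t ht p hpt
    exact ⟨r, hr, fun q hq => ⟨t, ht, hsub hq⟩⟩

/-- The attracting fixed point `g⁺ = lim_n gⁿ` of an (infinite order) element. -/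
def plusPt {S : Set Γ} (B : Boundary Γ S) (g : Γ) : B.pt := B.cls fun n => g ^ n

/-- The repelling fixed point `g⁻ = lim_n g⁻ⁿ` of an (infinite order) element. -/
def minusPt {S : Set Γ} (B : Boundary Γ S) (g : Γ) : B.pt := B.cls fun n => g⁻¹ ^ n

/-- A geodesic ray starting at the identity. -/
def IsGeodesicRay (S : Set Γ) (x : ℕ → Γ) : Prop :=
  x 0 = 1 ∧ ∀ m n : ℕ, wdist S (x m) (x n) = Nat.dist m n

/-- A geodesic ray from `e` to the boundary point `ξ`, i.e. an element of `[e,ξ]`. -/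
def RayTo {S : Set Γ} (B : Boundary Γ S) (x : ℕ → Γ) (ξ : B.pt) : Prop :=
  IsGeodesicRay S x ∧ ConvInf S x ∧ B.cls x = ξ

/-- A geodesic segment from `x` to `y` (parametrized on `0,…,d(x,y)`),
i.e. an element of `[x,y]`. -/
def IsGeodesicSeg (S : Set Γ) (x y : Γ) (α : ℕ → Γ) : Prop :=
  α 0 = x ∧ α (wdist S x y) = y ∧
  ∀ m n : ℕ, m ≤ wdist S x y → n ≤ wdist S x y → wdist S (α m) (α n) = Nat.dist m n

/-- The boundary "cylinder" `U(ξ,R)`: all `η` such that for every pair of geodesic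
rays `x ∈ [e,ξ]`, `y ∈ [e,η]` one has `lim_n (x(n)|y(n)) > R` (the sequence
`(x(n)|y(n))` is nondecreasing, so the limit exceeds `R` iff some term does). -/
def Uset {S : Set Γ} (B : Boundary Γ S) (ξ : B.pt) (R : ℝ) : Set B.pt :=
  {η | ∀ x y : ℕ → Γ, RayTo B x ξ → RayTo B y η → ∃ n : ℕ, R < gp S 1 (x n) (y n)}

/-- `C_r(p) = {g | (g|e)_p > r}`. -/
def Cset (S : Set Γ) (p : Γ) (r : ℝ) : Set Γ := {g | r < gp S p g 1}

/-- The `R`-neighbourhood `N(α,R)` of a geodesic segment `α ∈ [x,y]`. -/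
def segN (S : Set Γ) (x y : Γ) (α : ℕ → Γ) (R : ℝ) : Set Γ :=
  {g | ∃ i ≤ wdist S x y, (wdist S g (α i) : ℝ) ≤ R}

/-- The `R`-neighbourhood `N(A,R)` of a subset `A ⊆ Γ`. -/
def setN (S : Set Γ) (A : Set Γ) (R : ℝ) : Set Γ :=
  {g | ∃ a ∈ A, (wdist S g a : ℝ) ≤ R}

/-- `μ` is a nondegenerate probability measure on `Γ` with support contained in `S`:
nonnegative, of total mass one, supported in `S`, and the semigroup generated by its
support is the whole of `Γ`. -/
structure IsRWMeasure (S : Set Γ) (μ : Γ → ℝ) : Prop where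
  nonneg : ∀ g, 0 ≤ μ g
  support_subset : ∀ g, μ g ≠ 0 → g ∈ S
  total : ∑' g : Γ, μ g = 1
  nondeg : ∀ g : Γ, ∃ l : List Γ, l ≠ [] ∧ (∀ x ∈ l, 0 < μ x) ∧ l.prod = g

open Classical in
/-- `n`-step transition probabilities `p⁽ⁿ⁾(x,y) = μ*ⁿ(x⁻¹y)` of the random walk. -/
noncomputable def ptrans (μ : Γ → ℝ) : ℕ → Γ → Γ → ℝ
  | 0 => fun x y => if x = y then 1 else 0
  | n + 1 => fun x y => ∑' z : Γ, ptrans μ n x z * μ (z⁻¹ * y)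

/-- Green function `G(x,y) = Σ_n p⁽ⁿ⁾(x,y)`. -/
noncomputable def green (μ : Γ → ℝ) (x y : Γ) : ℝ := ∑' n : ℕ, ptrans μ n x y

/-- `F(x,y) = G(x,y)/G(y,y)`, the probability that the walk from `x` ever hits `y`. -/
noncomputable def greenF (μ : Γ → ℝ) (x y : Γ) : ℝ := green μ x y / green μ y y

/-- The Martin kernel `K(x,y) = G(x,y)/G(e,y)`. -/
noncomputable def martinK (μ : Γ → ℝ) (x y : Γ) : ℝ := green μ x y / green μ 1 y

open Classical in
/-- Transition probabilities of the walk restricted to `Δ` (killed when leaving `Δ`). -/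
noncomputable def ptransR (μ : Γ → ℝ) (Δ : Set Γ) : ℕ → Γ → Γ → ℝ
  | 0 => fun x y => if x = y ∧ x ∈ Δ then 1 else 0
  | n + 1 => fun x y => if y ∈ Δ then ∑' z : Γ, ptransR μ Δ n x z * μ (z⁻¹ * y) else 0

/-- Green function `G_Δ` of the restricted walk. -/
noncomputable def greenR (μ : Γ → ℝ) (Δ : Set Γ) (x y : Γ) : ℝ := ∑' n : ℕ, ptransR μ Δ n x y

/-- `F_Δ(x,y) = G_Δ(x,y)/G_Δ(y,y)`. -/
noncomputable def greenFR (μ : Γ → ℝ) (Δ : Set Γ) (x y : Γ) : ℝ :=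
  greenR μ Δ x y / greenR μ Δ y y

/-- Generating function `G_Δ(x,y|z) = Σ_n p_Δ⁽ⁿ⁾(x,y) zⁿ`. -/
noncomputable def greenRZ (μ : Γ → ℝ) (Δ : Set Γ) (x y : Γ) (z : ℝ) : ℝ :=
  ∑' n : ℕ, ptransR μ Δ n x y * z ^ n

/-- Spectral radius `ρ(P) = lim_n p⁽ⁿ⁾(e,e)^{1/n}` of the walk. -/
noncomputable def specRad (μ : Γ → ℝ) : ℝ :=
  Filter.limsup (fun n : ℕ => (ptrans μ n 1 1) ^ ((n : ℝ)⁻¹)) atTop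

/-- `u` is harmonic on `Λ`: `Σ_h p(g,h) u(h) = u(g)` for `g ∈ Λ`, `p(g,h)=μ(g⁻¹h)`. -/
def HarmonicOn (μ : Γ → ℝ) (u : Γ → ℝ) (Λ : Set Γ) : Prop :=
  ∀ g ∈ Λ, (∑' h : Γ, μ (g⁻¹ * h) * u h) = u g

/-- `u` vanishes at infinity on `Λ`: `u(g_n) → 0` along sequences in `Λ` with `|g_n|→∞`. -/
def VanishesAtInftyOn (S : Set Γ) (u : Γ → ℝ) (Λ : Set Γ) : Prop :=
  ∀ ε : ℝ, 0 < ε → ∃ M : ℕ, ∀ g ∈ Λ, M ≤ wl S g → |u g| ≤ ε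

open Classical in
/-- `r(g) = K(g⁻¹,g⁺)` for infinite order `g`, and `r(g) = 1` for finite order `g`;
here `Kb` is the boundary extension of the Martin kernel. -/
noncomputable def rfun {S : Set Γ} (B : Boundary Γ S) (Kb : Γ → B.pt → ℝ) (g : Γ) : ℝ :=
  if IsOfFinOrder g then 1 else Kb g⁻¹ (plusPt B g)

/-- The ratio set `r(Γ,∂Γ,ν)`: all `l ≥ 0` such that for every `ε > 0` and every
Borel `A` of positive measure there is `g ∈ Γ` such that
`{ω ∈ gA ∩ A : |d(gν)/dν(ω) − l| < ε}` has positive measure; here the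
Radon–Nikodym derivative `d(gν)/dν` is the Martin kernel `Kb g`. -/
def ratioSet {S : Set Γ} (B : Boundary Γ S) [MeasurableSpace B.pt]
    (ν : Measure B.pt) (Kb : Γ → B.pt → ℝ) : Set ℝ :=
  {l : ℝ | 0 ≤ l ∧ ∀ ε : ℝ, 0 < ε → ∀ A : Set B.pt, MeasurableSet A → 0 < ν A →
    ∃ g : Γ, 0 < ν {ω | ω ∈ A ∧ B.smul g⁻¹ ω ∈ A ∧ |Kb g ω - l| < ε}}

/-- A left invariant finitely additive mean on `Γ`; `Γ` is amenable iff one exists. -/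
structure InvariantMean (Γ : Type) [Group Γ] where
  m : Set Γ → ℝ
  nonneg : ∀ A, 0 ≤ m A
  total : m Set.univ = 1
  fin_add : ∀ A B : Set Γ, Disjoint A B → m (A ∪ B) = m A + m B
  invariant : ∀ (g : Γ) (A : Set Γ), m ((g * ·) ⁻¹' A) = m A


section MetricPart

variable {S : Set Γ}

lemma wl_exists (hS : IsGenSet S) (g : Γ) :
    ∃ w : List Γ, w.length = wl S g ∧ (∀ x ∈ w, x ∈ S) ∧ w.prod = g := by
  have hne : {n : ℕ | ∃ w : List Γ, w.length = n ∧ (∀ x ∈ w, x ∈ S) ∧ w.prod = g}.Nonempty := by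
    have hg : g ∈ Subgroup.closure S := by rw [hS.2.2]; trivial
    rw [← Subgroup.mem_toSubmonoid, Subgroup.closure_toSubmonoid] at hg
    obtain ⟨l, hl, hp⟩ := Submonoid.exists_list_of_mem_closure hg
    refine ⟨l.length, l, rfl, ?_, hp⟩
    intro x hx
    rcases hl x hx with h | h
    · exact h
    · simpa using hS.2.1 _ h
  exact Nat.sInf_mem hne

lemma wl_le_of_word (w : List Γ) (hw : ∀ x ∈ w, x ∈ S) : wl S w.prod ≤ w.length :=
  Nat.sInf_le ⟨w, rfl, hw, rfl⟩

lemma wl_one : wl S (1 : Γ) = 0 := by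
  have := wl_le_of_word (S := S) ([] : List Γ) (by simp)
  simpa using this

lemma wl_mul_le (hS : IsGenSet S) (g h : Γ) : wl S (g * h) ≤ wl S g + wl S h := by
  obtain ⟨w, hw, hw', rfl⟩ := wl_exists hS g
  obtain ⟨v, hv, hv', rfl⟩ := wl_exists hS h
  rw [← hw, ← hv, ← List.prod_append, ← List.length_append]
  apply wl_le_of_word
  intro x hx
  rcases List.mem_append.1 hx with h | h
  exacts [hw' x h, hv' x h]

lemma wl_inv_le (hS : IsGenSet S) (g : Γ) : wl S g⁻¹ ≤ wl S g := by
  obtain ⟨w, hw, hw', rfl⟩ := wl_exists hS g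
  rw [← hw, List.prod_inv_reverse]
  refine (wl_le_of_word _ ?_).trans (by simp)
  intro x hx
  simp only [List.mem_reverse, List.mem_map] at hx
  obtain ⟨y, hy, rfl⟩ := hx
  exact hS.2.1 _ (hw' y hy)

lemma wl_inv (hS : IsGenSet S) (g : Γ) : wl S g⁻¹ = wl S g :=
  le_antisymm (wl_inv_le hS g) (by simpa using wl_inv_le hS g⁻¹)

lemma wl_gen {s : Γ} (hs : s ∈ S) : wl S s ≤ 1 := by
  have := wl_le_of_word (S := S) [s] (by simpa using hs)
  simpa using this

lemma wd_self (x : Γ) : wdist S x x = 0 := by simp [wdist, wl_one]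

lemma wd_comm (hS : IsGenSet S) (x y : Γ) : wdist S x y = wdist S y x := by
  unfold wdist
  rw [← wl_inv hS]; simp

lemma wd_tri (hS : IsGenSet S) (x y z : Γ) : wdist S x z ≤ wdist S x y + wdist S y z := by
  unfold wdist
  have := wl_mul_le hS (x⁻¹ * y) (y⁻¹ * z)
  simpa [mul_assoc] using this

lemma wd_left (g x y : Γ) : wdist S (g * x) (g * y) = wdist S x y := by
  simp [wdist, mul_assoc]

lemma wd_one (x : Γ) : wdist S 1 x = wl S x := by simp [wdist]

lemma wd_one' (hS : IsGenSet S) (x : Γ) : wdist S x 1 = wl S x := by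
  rw [wd_comm hS, wd_one]

lemma ball_finite (hS : IsGenSet S) (n : ℕ) : {g : Γ | wl S g ≤ n}.Finite := by
  induction n with
  | zero =>
    refine (Set.finite_singleton (1 : Γ)).subset ?_
    intro g hg
    obtain ⟨w, hw, hw', rfl⟩ := wl_exists hS g
    have : w.length = 0 := by
      have : wl S w.prod ≤ 0 := hg
      omega
    simp [List.length_eq_zero_iff.1 this]
  | succ n ih =>
    refine (Set.Finite.union ih (Set.Finite.image2 (fun a b => a * b) hS.1 ih)).subset ?_
    intro g hg
    obtain ⟨w, hw, hw', rfl⟩ := wl_exists hS g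
    have hg : wl S w.prod ≤ n + 1 := hg
    cases w with
    | nil => left; simp [wl_one]
    | cons a l =>
      right
      refine ⟨a, hw' a (by simp), l.prod, ?_, by simp⟩
      have : wl S l.prod ≤ l.length := wl_le_of_word l (fun x hx => hw' x (by simp [hx]))
      simp only [List.length_cons] at hw
      show wl S l.prod ≤ n
      omega

/-- geodesics exist -/
lemma geod_exists (hS : IsGenSet S) (x y : Γ) : ∃ γ : ℕ → Γ, γ 0 = x ∧ γ (wdist S x y) = y ∧
    ∀ i j : ℕ, i ≤ j → j ≤ wdist S x y → wdist S (γ i) (γ j) = j - i := by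
  obtain ⟨w, hw, hw', hp⟩ := wl_exists hS (x⁻¹ * y)
  have hlen : w.length = wdist S x y := hw
  have hle : ∀ i j : ℕ, i ≤ j → wdist S (x * (w.take i).prod) (x * (w.take j).prod) ≤ j - i := by
    intro i j hij
    rw [wd_left]
    unfold wdist
    have h1 : w.take j = w.take i ++ (w.drop i).take (j - i) := by
      rw [← List.take_add]; congr 1; omega
    rw [h1, List.prod_append, inv_mul_cancel_left]
    refine (wl_le_of_word _ ?_).trans ?_
    · intro z hz
      exact hw' z (List.mem_of_mem_drop (List.mem_of_mem_take hz))
    · simp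
  refine ⟨fun i => x * (w.take i).prod, by simp, ?_, ?_⟩
  · simp [← hlen, hp]
  · intro i j hij hj
    have h0 : x * (w.take 0).prod = x := by simp
    have h3 : x * (w.take (wdist S x y)).prod = y := by simp [← hlen, hp]
    have h1 := hle 0 i (by omega)
    have h2 := hle j (wdist S x y) hj
    have h4 := hle i j hij
    rw [h0] at h1
    rw [h3] at h2
    have t1 := wd_tri hS x (x * (w.take i).prod) y
    have t2 := wd_tri hS (x * (w.take i).prod) (x * (w.take j).prod) y
    simp only
    omega

lemma gp_comm (hS : IsGenSet S) (b x y : Γ) : gp S b x y = gp S b y x := by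
  unfold gp; rw [wd_comm hS x y]; ring

lemma gp_left (g b x y : Γ) : gp S (g * b) (g * x) (g * y) = gp S b x y := by
  unfold gp; simp only [wd_left]

lemma gp_nonneg (hS : IsGenSet S) (b x y : Γ) : 0 ≤ gp S b x y := by
  have h := wd_tri hS x b y
  rw [wd_comm hS b y] at h
  have h' : (wdist S x y : ℝ) ≤ wdist S x b + wdist S y b := by exact_mod_cast h
  unfold gp; linarith

lemma gp_le_left (hS : IsGenSet S) (b x y : Γ) : gp S b x y ≤ wdist S x b := by
  have h := wd_tri hS y x b
  rw [wd_comm hS y x] at h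
  have h' : (wdist S y b : ℝ) ≤ wdist S x y + wdist S x b := by exact_mod_cast h
  unfold gp; linarith

lemma gp_le_right (hS : IsGenSet S) (b x y : Γ) : gp S b x y ≤ wdist S y b := by
  rw [gp_comm hS]; exact gp_le_left hS b y x

lemma gp_lip (hS : IsGenSet S) (b x x' y : Γ) : gp S b x y ≤ gp S b x' y + wdist S x x' := by
  have h := wd_tri hS x x' b
  have h2 := wd_tri hS x' x y
  rw [wd_comm hS x' x] at h2
  have h' : (wdist S x b : ℝ) ≤ wdist S x x' + wdist S x' b := by exact_mod_cast h
  have h2' : (wdist S x' y : ℝ) ≤ wdist S x x' + wdist S x y := by exact_mod_cast h2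
  unfold gp; linarith

lemma gp_self (b x : Γ) : gp S b x x = wdist S x b := by
  unfold gp; rw [wd_self]; push_cast; ring

/-- four point condition at an arbitrary base point -/
lemma hyp4 {δ : ℝ} (hδ : IsHyperbolic S δ) (hS : IsGenSet S) (b x y z : Γ) :
    gp S b x z - δ ≤ gp S b x y ∨ gp S b z y - δ ≤ gp S b x y := by
  have h := hδ.2 (b⁻¹ * x) (b⁻¹ * y) (b⁻¹ * z)
  have e : ∀ u v : Γ, gp S 1 (b⁻¹ * u) (b⁻¹ * v) = gp S b u v := by
    intro u v
    have := gp_left (S := S) b⁻¹ b u v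
    simpa using this
  rw [e, e, e] at h
  rcases min_cases (gp S b x z) (gp S b y z) with ⟨h1, _⟩ | ⟨h1, _⟩
  · left; linarith
  · right; rw [gp_comm hS b z y]; linarith

lemma hyp_nat {δ : ℝ} (hδ : IsHyperbolic S δ) : ∃ D : ℕ, 1 ≤ D ∧ IsHyperbolic S (D : ℝ) := by
  obtain ⟨n, hn⟩ := exists_nat_ge δ
  refine ⟨n + 1, by omega, by positivity, fun x y z => ?_⟩
  have := hδ.2 x y z
  push_cast
  linarith

/-- `(x|y)_e` through lengths of products -/
lemma gp_one (hS : IsGenSet S) (x y : Γ) :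
    gp S 1 x y = ((wl S x : ℝ) + wl S y - wl S (x⁻¹ * y)) / 2 := by
  unfold gp; rw [wd_one' hS, wd_one' hS]; rfl

lemma wl_mul_eq (hS : IsGenSet S) (x y : Γ) :
    (wl S (x * y) : ℝ) = wl S x + wl S y - 2 * gp S 1 x⁻¹ y := by
  rw [gp_one hS, wl_inv hS, inv_inv]; ring

lemma gp_mul_self (hS : IsGenSet S) (x y : Γ) :
    gp S 1 x (x * y) = wl S x - gp S 1 x⁻¹ y := by
  rw [gp_one hS, inv_mul_cancel_left, wl_mul_eq hS]; ring

end MetricPart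
section GrowthPart

variable {S : Set Γ}

lemma far_exists (hS : IsGenSet S) (hne : Nonelementary Γ) (n : ℕ) : ∃ x : Γ, n ≤ wl S x := by
  by_contra hcon
  push Not at hcon
  have hfin : (Set.univ : Set Γ).Finite :=
    (ball_finite hS n).subset (fun x _ => (hcon x).le)
  have h1 := hne 1
  rw [Subgroup.zpowers_one_eq_bot, Subgroup.index_bot] at h1
  have : Finite Γ := Set.finite_univ_iff.1 hfin
  exact absurd h1 (Nat.card_pos).ne'

lemma lox_exists (hS : IsGenSet S) (hne : Nonelementary Γ) {δ : ℝ} (hδ : IsHyperbolic S δ)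
    (C : ℝ) (hC : 0 ≤ C) : ∃ g : Γ, 2 * gp S 1 g g⁻¹ + C ≤ wl S g := by
  obtain ⟨n, hn⟩ := exists_nat_gt (8 * δ + C + 1)
  obtain ⟨x, hx⟩ := far_exists hS hne (2 * n)
  obtain ⟨γ, h0, h1, hγ⟩ := geod_exists hS 1 x
  rw [wd_one] at hγ
  have hδ0 := hδ.1
  set g := (γ n)⁻¹ * γ 0 with hg
  set h := (γ n)⁻¹ * γ (2 * n) with hh
  have lg : wl S g = n := by
    have := hγ 0 n (by omega) (by omega)
    rw [wd_comm hS] at this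
    simpa [wdist] using this
  have lh : wl S h = n := by
    have := hγ n (2 * n) (by omega) (by omega)
    simp only [wdist] at this
    rw [hh, this]; omega
  have lgh : wl S (g⁻¹ * h) = 2 * n := by
    have := hγ 0 (2 * n) (by omega) (by omega)
    simp only [wdist] at this
    rw [hg, hh]; simpa [mul_assoc] using this
  have g0 : gp S 1 g h = 0 := by
    rw [gp_one hS, lg, lh, lgh]; push_cast; ring
  by_cases hA : 2 * gp S 1 g g⁻¹ + C ≤ wl S g
  · exact ⟨g, hA⟩
  by_cases hB : 2 * gp S 1 h h⁻¹ + C ≤ wl S h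
  · exact ⟨h, hB⟩
  push Not at hA hB
  rw [lg] at hA
  rw [lh] at hB
  refine ⟨g * h, ?_⟩
  have e1 : gp S 1 g⁻¹ h ≤ δ := by
    rcases hyp4 hδ hS 1 g h g⁻¹ with h | h <;> linarith
  have e2 : gp S 1 g h⁻¹ ≤ δ := by
    rcases hyp4 hδ hS 1 g h h⁻¹ with h' | h'
    · linarith
    · rw [gp_comm hS 1 h⁻¹ h] at h'; linarith
  have lw := wl_mul_eq hS g h
  have p1 := gp_mul_self hS g h
  have p2 := gp_mul_self hS h⁻¹ g⁻¹
  rw [inv_inv, wl_inv hS, gp_comm hS 1 h g⁻¹] at p2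
  rw [lg] at p1
  rw [lh] at p2
  rw [lg, lh] at lw
  have e3 : gp S 1 g (h⁻¹ * g⁻¹) ≤ 2 * δ := by
    rcases hyp4 hδ hS 1 g h⁻¹ (h⁻¹ * g⁻¹) with h' | h'
    · linarith
    · rw [gp_comm hS 1 (h⁻¹ * g⁻¹)] at h'; linarith
  have e4 : gp S 1 (g * h) (h⁻¹ * g⁻¹) ≤ 3 * δ := by
    rcases hyp4 hδ hS 1 g (h⁻¹ * g⁻¹) (g * h) with h' | h'
    · linarith
    · linarith
  rw [mul_inv_rev]
  linarith

lemma lox_pow (hS : IsGenSet S) {δ : ℝ} (hδ : IsHyperbolic S δ) (g : Γ)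
    (hg : 2 * gp S 1 g g⁻¹ + (4 * δ + 1) ≤ wl S g) (n : ℕ) :
    gp S 1 g⁻¹ (g ^ (n + 1)) ≤ gp S 1 g g⁻¹ + δ ∧
    wl S g - gp S 1 g g⁻¹ - δ ≤ gp S 1 g (g ^ (n + 1)) ∧ ((n + 1 : ℕ) : ℝ) ≤ wl S (g ^ (n + 1)) := by
  have hδ0 := hδ.1
  have hq := gp_nonneg hS 1 g g⁻¹
  induction n with
  | zero =>
    simp only [zero_add, pow_one]
    rw [gp_comm hS 1 g⁻¹ g, gp_self, wd_one' hS]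
    refine ⟨by linarith, by linarith, by push_cast; linarith⟩
  | succ n ih =>
    obtain ⟨i1, i2, i3⟩ := ih
    have a := gp_mul_self hS g (g ^ (n + 1))
    have l := wl_mul_eq hS g (g ^ (n + 1))
    rw [← pow_succ'] at a l
    refine ⟨?_, by linarith, by push_cast at *; linarith⟩
    rcases hyp4 hδ hS 1 g⁻¹ g (g ^ (n + 1 + 1)) with h' | h'
    · rw [gp_comm hS 1 g⁻¹ g] at h'; linarith
    · rw [gp_comm hS 1 g⁻¹ g, gp_comm hS 1 _ g] at h'; linarith

lemma lox_data (hS : IsGenSet S) (hne : Nonelementary Γ) {δ : ℝ} (hδ : IsHyperbolic S δ) :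
    ∃ (g : Γ) (c : ℝ), 0 ≤ c ∧ (∀ n : ℕ, (n : ℝ) ≤ wl S (g ^ n)) ∧ 
      (∀ i j : ℕ, gp S 1 (g⁻¹ ^ i) (g ^ j) ≤ c) := by
  have hδ0 := hδ.1
  obtain ⟨g, hg⟩ := lox_exists hS hne hδ (4 * δ + 1) (by linarith)
  have hq := gp_nonneg hS 1 g g⁻¹
  have hg' : 2 * gp S 1 g⁻¹ g⁻¹⁻¹ + (4 * δ + 1) ≤ wl S g⁻¹ := by
    rw [inv_inv, gp_comm hS, wl_inv hS]; exact hg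
  refine ⟨g, gp S 1 g g⁻¹ + 2 * δ, by linarith, ?_, ?_⟩
  · intro n
    cases n with
    | zero => simp
    | succ n => exact (lox_pow hS hδ g hg n).2.2
  · intro i j
    cases i with
    | zero =>
      have := gp_le_left hS 1 1 (g ^ j)
      rw [wd_self] at this
      simp only [pow_zero]; push_cast at this; linarith
    | succ i =>
      cases j with
      | zero =>
        have := gp_le_right hS 1 (g⁻¹ ^ (i + 1)) 1
        rw [wd_self] at this
        simp only [pow_zero]; push_cast at this; linarith
      | succ j =>
        obtain ⟨a1, a2, -⟩ := lox_pow hS hδ g hg j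
        obtain ⟨b1, b2, -⟩ := lox_pow hS hδ g⁻¹ hg' i
        rw [inv_inv, gp_comm hS 1 g⁻¹ g] at b1 b2
        rw [wl_inv hS] at b2
        rw [gp_comm hS]
        rw [gp_comm hS] at a1
        rcases hyp4 hδ hS 1 (g ^ (j + 1)) g⁻¹ (g⁻¹ ^ (i + 1)) with h' | h'
        · linarith
        · rw [gp_comm hS 1 _ g⁻¹] at h'; linarith

lemma coset_min_bound (hS : IsGenSet S) {δ : ℝ} (hδ : IsHyperbolic S δ) (g : Γ) (c : ℝ)
    (hc : 0 ≤ c)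
    (h1 : ∀ n : ℕ, (n : ℝ) ≤ wl S (g ^ n)) (h2 : ∀ i j : ℕ, gp S 1 (g⁻¹ ^ i) (g ^ j) ≤ c) :
    ∃ C : ℝ, ∀ t : Γ, (∀ j : ℕ, wl S t ≤ wl S (g⁻¹ ^ j * t)) → ∀ j : ℕ, gp S 1 t (g ^ j) ≤ C := by
  have hδ0 := hδ.1
  obtain ⟨i0, hi0⟩ := exists_nat_gt (2 * c + 2 * δ)
  refine ⟨∑ j ∈ Finset.range (i0 + 1), (wl S (g ^ j) : ℝ) + δ, fun t ht j => ?_⟩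
  have key : ∀ j : ℕ, gp S 1 t (g ^ j) ≤ wl S (g ^ j) / 2 := by
    intro j
    rw [gp_comm hS, gp_one hS, ← inv_pow]
    have : (wl S t : ℝ) ≤ wl S (g⁻¹ ^ j * t) := by exact_mod_cast ht j
    linarith
  have hsum : ∀ j ≤ i0, (wl S (g ^ j) : ℝ) ≤ ∑ j ∈ Finset.range (i0 + 1), (wl S (g ^ j) : ℝ) := by
    intro j hj
    exact Finset.single_le_sum (f := fun j => (wl S (g ^ j) : ℝ)) (fun _ _ => by positivity)
      (Finset.mem_range.2 (by omega))
  by_cases hj : j ≤ i0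
  · have a := key j
    have b := hsum j hj
    have : (0 : ℝ) ≤ wl S (g ^ j) := by positivity
    linarith
  · have a := key i0
    have b := hsum i0 le_rfl
    have d := h1 i0
    have e := gp_mul_self hS (g ^ i0) (g ^ (j - i0))
    rw [← pow_add, ← inv_pow] at e
    rw [show i0 + (j - i0) = j by omega] at e
    have f := h2 i0 (j - i0)
    rcases hyp4 hδ hS 1 t (g ^ i0) (g ^ j) with h' | h'
    · linarith
    · rw [gp_comm hS 1 (g ^ j)] at h'
      linarith

lemma coset_min_exists (hS : IsGenSet S) (hne : Nonelementary Γ) (g : Γ) (n : ℕ) :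
    ∃ t : Γ, n ≤ wl S t ∧ ∀ j : ℤ, wl S t ≤ wl S (g ^ j * t) := by
  by_contra hcon
  push Not at hcon
  have hmin : ∀ x : Γ, ∃ j : ℤ, wl S (g ^ j * x) < n := by
    intro x
    by_contra hx
    push Not at hx
    obtain ⟨j0, hj0⟩ : ∃ j0 : ℤ, ∀ j : ℤ, wl S (g ^ j0 * x) ≤ wl S (g ^ j * x) := by
      obtain ⟨m, ⟨j0, hj0⟩, hm⟩ := WellFounded.has_min (wellFounded_lt (α := ℕ))
        (Set.range fun j : ℤ => wl S (g ^ j * x)) ⟨_, 0, rfl⟩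
      refine ⟨j0, fun j => ?_⟩
      have := hm _ ⟨j, rfl⟩
      simp only at hj0
      rw [hj0]; exact not_lt.1 this
    obtain ⟨j, hj⟩ := hcon _ (hx j0)
    rw [← mul_assoc, ← zpow_add] at hj
    exact absurd (hj0 (j + j0)) (not_le.2 hj)
  have hi := hne g
  rw [Subgroup.index, Nat.card_eq_zero] at hi
  rcases hi with hi | hi
  · exact hi.elim (QuotientGroup.mk (1 : Γ))
  · have hf : Finite {t : Γ | wl S t ≤ n} := (ball_finite hS n).to_subtype
    have : Finite (Γ ⧸ Subgroup.zpowers g) := by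
      refine Finite.of_surjective
        (fun t : {t : Γ | wl S t ≤ n} => (QuotientGroup.mk (t.1⁻¹) : Γ ⧸ Subgroup.zpowers g)) ?_
      intro y
      obtain ⟨x, rfl⟩ := QuotientGroup.mk_surjective y
      obtain ⟨j, hj⟩ := hmin x⁻¹
      refine ⟨⟨g ^ j * x⁻¹, hj.le⟩, ?_⟩
      rw [QuotientGroup.eq]
      simp only [inv_inv]
      rw [Subgroup.mem_zpowers_iff]
      exact ⟨j, by group⟩
    exact not_finite (Γ ⧸ Subgroup.zpowers g)

lemma branch (hS : IsGenSet S) (hne : Nonelementary Γ) {δ : ℝ} (hδ : IsHyperbolic S δ) :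
    ∃ c : ℝ, 0 ≤ c ∧ ∀ n : ℕ, ∃ N : ℕ, ∀ w : Γ, ∃ h h' : Γ, n ≤ wl S h ∧ n ≤ wl S h' ∧
      wl S h ≤ N ∧ wl S h' ≤ N ∧ gp S 1 h h' ≤ c ∧ gp S 1 w⁻¹ h ≤ c ∧ gp S 1 w⁻¹ h' ≤ c := by
  have hδ0 := hδ.1
  obtain ⟨g, c, hc, h1, h2⟩ := lox_data hS hne hδ
  have h1' : ∀ n : ℕ, (n : ℝ) ≤ wl S (g⁻¹ ^ n) := by
    intro n; rw [inv_pow, wl_inv hS]; exact h1 n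
  have h2' : ∀ i j : ℕ, gp S 1 (g⁻¹⁻¹ ^ i) (g⁻¹ ^ j) ≤ c := by
    intro i j; rw [inv_inv, gp_comm hS]; exact h2 j i
  obtain ⟨C1, hC1⟩ := coset_min_bound hS hδ g c hc h1 h2
  obtain ⟨C2, hC2⟩ := coset_min_bound hS hδ g⁻¹ c hc h1' h2'
  refine ⟨c + |C1| + |C2| + δ, by positivity, fun n => ?_⟩
  obtain ⟨t, ht, ht2⟩ := coset_min_exists hS hne g n
  have b1 : gp S 1 t (g ^ n) ≤ C1 := hC1 t (fun j => by
    have := ht2 (-j); simpa using this) n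
  have b2 : gp S 1 t (g⁻¹ ^ n) ≤ C2 := hC2 t (fun j => by
    have := ht2 j; simpa using this) n
  have b3 := h2 n n
  have l1 : n ≤ wl S (g ^ n) := by exact_mod_cast h1 n
  have l2 : n ≤ wl S (g⁻¹ ^ n) := by exact_mod_cast h1' n
  have p1 := le_abs_self C1
  have p2 := le_abs_self C2
  have p1' := abs_nonneg C1
  have p2' := abs_nonneg C2
  refine ⟨wl S (g ^ n) + wl S (g⁻¹ ^ n) + wl S t, fun w => ?_⟩
  set K := c + |C1| + |C2| with hK
  have two : ∀ a b : Γ, gp S 1 a b ≤ K → gp S 1 w⁻¹ a ≤ K + δ ∨ gp S 1 w⁻¹ b ≤ K + δ := by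
    intro a b hab
    rcases hyp4 hδ hS 1 a b w⁻¹ with h | h
    · left; rw [gp_comm hS]; linarith
    · right; linarith
  by_cases q1 : gp S 1 w⁻¹ t ≤ K + δ
  · rcases two _ _ (b3.trans (by linarith)) with q2 | q2
    · exact ⟨t, g⁻¹ ^ n, ht, l2, by omega, by omega, by linarith, q1, q2⟩
    · exact ⟨t, g ^ n, ht, l1, by omega, by omega, by linarith, q1, q2⟩
  · have q2 := (two _ _ (b1.trans (by linarith))).resolve_left q1
    have q3 := (two _ _ (b2.trans (by linarith))).resolve_left q1
    exact ⟨g⁻¹ ^ n, g ^ n, l2, l1, by omega, by omega, by linarith, q3, q2⟩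

/-- exponential growth -/
lemma exp_growth (hS : IsGenSet S) (hne : Nonelementary Γ) {δ : ℝ} (hδ : IsHyperbolic S δ) :
    ∃ N : ℕ, ∀ k : ℕ, 2 ^ k ≤ {g : Γ | wl S g ≤ k * N}.ncard := by
  classical
  have hδ0 := hδ.1
  obtain ⟨c, hc, hb⟩ := branch hS hne hδ
  set c2 := c + 2 * δ + 1 with hc2
  obtain ⟨n, hn⟩ := exists_nat_gt (3 * c + c2 + 2 * δ)
  obtain ⟨N, hN⟩ := hb n
  choose h h' a1 a2 a3 a4 a5 a6 a7 using hN
  refine ⟨N, fun k => ?_⟩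
  suffices H : ∃ A : Finset Γ, A.card = 2 ^ k ∧ (∀ w ∈ A, wl S w ≤ k * N) ∧
      ∀ w ∈ A, ∀ w' ∈ A, w ≠ w' → gp S 1 w w' < wl S w - c2 by
    obtain ⟨A, hA, hA2, -⟩ := H
    rw [← hA, ← Set.ncard_coe_finset]
    exact Set.ncard_le_ncard (fun w hw => hA2 w hw) (ball_finite hS _)
  induction k with
  | zero =>
    refine ⟨{1}, by simp, by simp [wl_one], ?_⟩
    intro w hw w' hw' hne
    simp only [Finset.mem_singleton] at hw hw'
    exact absurd (hw.trans hw'.symm) hne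
  | succ k ih =>
    obtain ⟨A, hA, hA2, hA3⟩ := ih
    let H : Γ → Bool → Γ := fun w b => if b then h w else h' w
    have H1 : ∀ w b, (n : ℝ) ≤ wl S (H w b) := by
      intro w b; cases b <;> simp only [H] <;> simp [a1, a2]
    have H2 : ∀ w b, wl S (H w b) ≤ N := by
      intro w b; cases b <;> simp only [H] <;> simp [a3, a4]
    have H3 : ∀ w b, gp S 1 w⁻¹ (H w b) ≤ c := by
      intro w b; cases b <;> simp only [H] <;> simp [a6, a7]
    have H4 : ∀ w b b', b ≠ b' → gp S 1 (H w b) (H w b') ≤ c := by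
      intro w b b' hb
      cases b <;> cases b' <;> simp only [H] <;> simp_all
      rw [gp_comm hS]; exact a5 w
    have main : ∀ w ∈ A, ∀ w' ∈ A, ∀ b b', (w, b) ≠ (w', b') →
        gp S 1 (w * H w b) (w' * H w' b') < wl S (w * H w b) - c2 := by
      intro w hw w' hw' b b' hne
      have L := wl_mul_eq hS w (H w b)
      have L1 := H1 w b
      have L2 := H3 w b
      have M1 := H1 w' b'
      have M2 := H3 w' b'
      have e1 := gp_mul_self hS w (H w b)
      have e2 := gp_mul_self hS w' (H w' b')
      by_cases hww : w = w'
      · subst hww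
        have hbb : b ≠ b' := fun h => hne (by rw [h])
        have f1 := H4 w b b' hbb
        have f2 : (wl S (w * H w b') : ℝ) ≤ wl S w + wl S (H w b') := by
          exact_mod_cast wl_mul_le hS w (H w b')
        have f3 : (wl S (w * H w b) : ℝ) ≤ wl S w + wl S (H w b) := by
          exact_mod_cast wl_mul_le hS w (H w b)
        rw [gp_one hS] at f1 ⊢
        rw [show (w * H w b)⁻¹ * (w * H w b') = (H w b)⁻¹ * H w b' by group]
        linarith
      · have s1 := hA3 w hw w' hw' hww
        have s2 := hA3 w' hw' w hw (Ne.symm hww)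
        rw [gp_comm hS 1 w' w] at s2
        have t1 : gp S 1 (w * H w b) w' ≤ gp S 1 w w' + δ := by
          rcases hyp4 hδ hS 1 w w' (w * H w b) with h' | h' <;> linarith
        rcases hyp4 hδ hS 1 (w * H w b) w' (w' * H w' b') with h' | h'
        · linarith
        · rw [gp_comm hS 1 _ w'] at h'; linarith
    have inj : Set.InjOn (fun q : Γ × Bool => q.1 * H q.1 q.2)
        ((A ×ˢ (Finset.univ : Finset Bool) : Finset (Γ × Bool)) : Set (Γ × Bool)) := by
      rintro ⟨w, b⟩ hq ⟨w', b'⟩ hq' heq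
      by_contra hcon
      simp only [Finset.coe_product, Set.mem_prod, Finset.mem_coe] at hq hq'
      have := main w hq.1 w' hq'.1 b b' hcon
      simp only at heq
      rw [← heq, gp_self, wd_one' hS] at this
      linarith
    refine ⟨(A ×ˢ (Finset.univ : Finset Bool)).image (fun q => q.1 * H q.1 q.2), ?_, ?_, ?_⟩
    · rw [Finset.card_image_of_injOn inj, Finset.card_product, hA]; simp [pow_succ]
    · intro x hx
      simp only [Finset.mem_image, Finset.mem_product, Finset.mem_univ, and_true] at hx
      obtain ⟨⟨w, b⟩, hw, rfl⟩ := hx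
      have := wl_mul_le hS w (H w b)
      have := H2 w b
      have := hA2 w hw
      simp only at *
      rw [add_mul, one_mul]; omega
    · intro x hx y hy hxy
      simp only [Finset.mem_image, Finset.mem_product, Finset.mem_univ, and_true] at hx hy
      obtain ⟨⟨w, b⟩, hw, rfl⟩ := hx
      obtain ⟨⟨w', b'⟩, hw', rfl⟩ := hy
      exact main w hw w' hw' b b' (by rintro ⟨⟩; exact hxy rfl)

end GrowthPart
section KernelPart

open Classical in
/-- identity kernel -/
noncomputable def kone (x y : Γ) : ℝ≥0∞ := if x = y then 1 else 0

/-- powers of a kernel -/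
noncomputable def kpow (K : Γ → Γ → ℝ≥0∞) : ℕ → Γ → Γ → ℝ≥0∞
  | 0 => kone
  | n + 1 => fun x z => ∑' y : Γ, K x y * kpow K n y z

lemma tsum_kone_left (x : Γ) (f : Γ → ℝ≥0∞) : ∑' y, kone x y * f y = f x := by
  rw [tsum_eq_single x]
  · simp [kone]
  · intro y hy; simp [kone, hy.symm]

lemma tsum_kone_right (z : Γ) (f : Γ → ℝ≥0∞) : ∑' y, f y * kone y z = f z := by
  rw [tsum_eq_single z]
  · simp [kone]
  · intro y hy; simp [kone, hy]

lemma kpow_zero (K : Γ → Γ → ℝ≥0∞) (x z : Γ) : kpow K 0 x z = kone x z := rfl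

lemma kpow_succ (K : Γ → Γ → ℝ≥0∞) (n : ℕ) (x z : Γ) :
    kpow K (n + 1) x z = ∑' y : Γ, K x y * kpow K n y z := rfl

lemma kpow_one (K : Γ → Γ → ℝ≥0∞) (x z : Γ) : kpow K 1 x z = K x z := by
  rw [kpow_succ]; simp only [kpow_zero]; rw [tsum_kone_right]

lemma ker_assoc (f : Γ → ℝ≥0∞) (L : Γ → Γ → ℝ≥0∞) (g : Γ → ℝ≥0∞) :
    ∑' y, f y * ∑' w, L y w * g w = ∑' w, (∑' y, f y * L y w) * g w := by
  simp only [← ENNReal.tsum_mul_left, ← ENNReal.tsum_mul_right]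
  rw [ENNReal.tsum_comm]
  simp only [mul_assoc]

lemma kpow_add (K : Γ → Γ → ℝ≥0∞) (m n : ℕ) (x z : Γ) :
    kpow K (m + n) x z = ∑' y : Γ, kpow K m x y * kpow K n y z := by
  induction m generalizing x with
  | zero => simp only [zero_add, kpow_zero]; rw [tsum_kone_left]
  | succ m ih =>
    rw [show m + 1 + n = (m + n) + 1 by ring, kpow_succ]
    simp only [ih]
    rw [ker_assoc]
    rfl

lemma kpow_succ' (K : Γ → Γ → ℝ≥0∞) (n : ℕ) (x z : Γ) :
    kpow K (n + 1) x z = ∑' y : Γ, kpow K n x y * K y z := by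
  rw [kpow_add]; simp only [kpow_one]

lemma kpow_mono {K L : Γ → Γ → ℝ≥0∞} (h : ∀ x y, K x y ≤ L x y) (n : ℕ) (x z : Γ) :
    kpow K n x z ≤ kpow L n x z := by
  induction n generalizing x with
  | zero => exact le_rfl
  | succ n ih => exact ENNReal.tsum_le_tsum fun y => mul_le_mul' (h x y) (ih y)

/-- the lazy transition kernel -/
noncomputable def PK (μ : Γ → ℝ) (x y : Γ) : ℝ≥0∞ :=
  2⁻¹ * kone x y + 2⁻¹ * ENNReal.ofReal (μ (x⁻¹ * y))

lemma kone_left (g x y : Γ) : kone (g * x) (g * y) = kone x y := by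
  unfold kone; congr 1; simp

lemma PK_left (μ : Γ → ℝ) (g x y : Γ) : PK μ (g * x) (g * y) = PK μ x y := by
  simp [PK, kone_left, mul_assoc]

lemma kpow_left {K : Γ → Γ → ℝ≥0∞} (hK : ∀ g x y, K (g * x) (g * y) = K x y) (n : ℕ) (g x z : Γ) :
    kpow K n (g * x) (g * z) = kpow K n x z := by
  induction n generalizing x with
  | zero => exact kone_left g x z
  | succ n ih =>
    rw [kpow_succ, kpow_succ, ← (Equiv.mulLeft g).tsum_eq]
    simp only [Equiv.coe_mulLeft, hK, ih]

variable {S : Set Γ} {μ : Γ → ℝ}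

lemma mu_sum (hμ : IsRWMeasure S μ) : ∑' g, ENNReal.ofReal (μ g) = 1 := by
  have hs : Summable μ := by
    by_contra h
    have := hμ.total
    rw [tsum_eq_zero_of_not_summable h] at this
    norm_num at this
  rw [← ENNReal.ofReal_tsum_of_nonneg hμ.nonneg hs, hμ.total, ENNReal.ofReal_one]

lemma half_add : (2⁻¹ : ℝ≥0∞) * 1 + 2⁻¹ * 1 = 1 := by
  simp [ENNReal.inv_two_add_inv_two]

lemma PK_row (hμ : IsRWMeasure S μ) (x : Γ) : ∑' y, PK μ x y = 1 := by
  unfold PK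
  rw [ENNReal.tsum_add, ENNReal.tsum_mul_left, ENNReal.tsum_mul_left]
  have h1 : ∑' y, kone x y = 1 := by simpa using tsum_kone_left x (fun _ => 1)
  have h2 : ∑' y, ENNReal.ofReal (μ (x⁻¹ * y)) = 1 := by
    rw [← mu_sum hμ, ← (Equiv.mulLeft x⁻¹).tsum_eq (fun g => ENNReal.ofReal (μ g))]
    rfl
  rw [h1, h2, half_add]

lemma PK_col (hμ : IsRWMeasure S μ) (y : Γ) : ∑' x, PK μ x y = 1 := by
  unfold PK
  rw [ENNReal.tsum_add, ENNReal.tsum_mul_left, ENNReal.tsum_mul_left]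
  have h1 : ∑' x, kone x y = 1 := by simpa using tsum_kone_right y (fun _ => 1)
  have h2 : ∑' x, ENNReal.ofReal (μ (x⁻¹ * y)) = 1 := by
    rw [← mu_sum hμ, ← ((Equiv.inv Γ).trans (Equiv.mulRight y)).tsum_eq
      (fun g => ENNReal.ofReal (μ g))]
    rfl
  rw [h1, h2, half_add]

lemma kpow_row {K : Γ → Γ → ℝ≥0∞} (hK : ∀ x, ∑' y, K x y = 1) (n : ℕ) (x : Γ) :
    ∑' y, kpow K n x y = 1 := by
  induction n generalizing x with
  | zero => simpa [kpow_zero] using tsum_kone_left x (fun _ => 1)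
  | succ n ih =>
    simp only [kpow_succ]
    rw [ENNReal.tsum_comm]
    simp only [ENNReal.tsum_mul_left, ih, mul_one, hK]

lemma kpow_col {K : Γ → Γ → ℝ≥0∞} (hK : ∀ y, ∑' x, K x y = 1) (n : ℕ) (z : Γ) :
    ∑' x, kpow K n x z = 1 := by
  induction n with
  | zero => simpa [kpow_zero] using tsum_kone_right z (fun _ => 1)
  | succ n ih =>
    simp only [kpow_succ]
    rw [ENNReal.tsum_comm]
    simp only [ENNReal.tsum_mul_right, hK, one_mul, ih]

lemma PK_near (hS : IsGenSet S) (hμ : IsRWMeasure S μ) {x y : Γ} (h : PK μ x y ≠ 0) :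
    wdist S x y ≤ 1 := by
  by_cases hxy : x = y
  · subst hxy; rw [wd_self]; omega
  · have : μ (x⁻¹ * y) ≠ 0 := by
      intro h0; apply h; simp [PK, kone, hxy, h0]
    exact wl_gen (hμ.support_subset _ this)

open Classical in
/-- the kernel restricted to `D` -/
noncomputable def QK (μ : Γ → ℝ) (D : Set Γ) (x y : Γ) : ℝ≥0∞ :=
  if x ∈ D ∧ y ∈ D then PK μ x y else 0

lemma QK_mono {D E : Set Γ} (h : D ⊆ E) (x y : Γ) : QK μ D x y ≤ QK μ E x y := by
  unfold QK
  split_ifs with h1 h2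
  · exact le_rfl
  · exact absurd ⟨h h1.1, h h1.2⟩ h2
  · exact zero_le
  · exact le_rfl

lemma QK_univ : QK μ Set.univ = PK μ := by
  funext x y; simp [QK]

lemma QK_le (D : Set Γ) (x y : Γ) : QK μ D x y ≤ PK μ x y := by
  rw [← QK_univ]; exact QK_mono (Set.subset_univ D) x y

lemma QK_of_mem {D : Set Γ} {x y : Γ} (hx : x ∈ D) (hy : y ∈ D) : QK μ D x y = PK μ x y := by
  simp [QK, hx, hy]

lemma kpow_near (hS : IsGenSet S) (hμ : IsRWMeasure S μ) (n : ℕ) {x z : Γ}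
    (h : kpow (PK μ) n x z ≠ 0) : wdist S x z ≤ n := by
  induction n generalizing x with
  | zero =>
    have : x = z := by
      by_contra hxz; apply h; simp [kpow_zero, kone, hxz]
    rw [this, wd_self]
  | succ n ih =>
    rw [kpow_succ] at h
    simp only [ne_eq, ENNReal.tsum_eq_zero, not_forall] at h
    obtain ⟨y, hy⟩ := h
    have h1 := PK_near hS hμ (left_ne_zero_of_mul hy)
    have h2 := ih (right_ne_zero_of_mul hy)
    have := wd_tri hS x y z
    omega

/-- uniform positivity of one step probabilities -/
lemma kappa_exists (hS : IsGenSet S) (hμ : IsRWMeasure S μ) :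
    ∃ κ : ℝ≥0∞, 0 < κ ∧ κ ≤ 2⁻¹ ∧ ∀ x s : Γ, 0 < μ s → κ ≤ PK μ x (x * s) := by
  classical
  have hfin : {s : Γ | 0 < μ s}.Finite :=
    hS.1.subset fun s hs => hμ.support_subset s (ne_of_gt hs)
  refine ⟨min 2⁻¹ (hfin.toFinset.inf fun s => 2⁻¹ * ENNReal.ofReal (μ s)), ?_, min_le_left _ _, ?_⟩
  · refine lt_min (by simp) ?_
    rw [Finset.lt_inf_iff (by simp)]
    intro s hs
    have : 0 < μ s := by simpa using hs
    refine ENNReal.mul_pos (by simp) ?_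
    simpa using this
  · intro x s hs
    refine (min_le_right _ _).trans ?_
    refine (Finset.inf_le (by simpa using hs)).trans ?_
    simp [PK]

/-- lower bound along a path -/
lemma path_lower {κ : ℝ≥0∞} (hκ : ∀ x s : Γ, 0 < μ s → κ ≤ PK μ x (x * s)) (D : Set Γ)
    (l : List Γ) (hl : ∀ s ∈ l, 0 < μ s) (x : Γ)
    (hD : ∀ i ≤ l.length, x * (l.take i).prod ∈ D) :
    κ ^ l.length ≤ kpow (QK μ D) l.length x (x * l.prod) := by
  induction l generalizing x with
  | nil => simp [kpow_zero, kone]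
  | cons a l ih =>
    rw [List.length_cons, pow_succ', kpow_succ, List.prod_cons, ← mul_assoc]
    have h0 : x ∈ D := by simpa using hD 0 (by simp)
    have h1 : x * a ∈ D := by simpa using hD 1 (by simp)
    refine le_trans ?_ (ENNReal.le_tsum (x * a))
    refine mul_le_mul' ?_ ?_
    · rw [QK_of_mem h0 h1]; exact hκ x a (hl a (by simp))
    · refine ih (fun s hs => hl s (by simp [hs])) (x * a) ?_
      intro i hi
      have := hD (i + 1) (by simpa using hi)
      simpa [mul_assoc] using this

/-- laziness -/
lemma kpow_lazy (n m : ℕ) (hnm : n ≤ m) (x z : Γ) (h : kpow (PK μ) n x z ≠ 0) :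
    kpow (PK μ) m x z ≠ 0 := by
  induction m, hnm using Nat.le_induction with
  | base => exact h
  | succ m _ ih =>
    rw [kpow_succ]
    intro h0
    rw [ENNReal.tsum_eq_zero] at h0
    have := h0 x
    rcases mul_eq_zero.1 this with h1 | h1
    · simp [PK, kone] at h1
    · exact ih h1

lemma minorize (hS : IsGenSet S) (hμ : IsRWMeasure S μ) (K : ℕ) :
    ∃ (m : ℕ) (c : ℝ≥0∞), 1 ≤ m ∧ 0 < c ∧ ∀ x y : Γ, wdist S x y ≤ K → c ≤ kpow (PK μ) m x y := by
  classical
  obtain ⟨κ, hκ0, -, hκ⟩ := kappa_exists hS hμ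
  choose L hL1 hL2 hL3 using hμ.nondeg
  set B := (ball_finite hS K).toFinset with hB
  set m := B.sup (fun w => (L w).length) + 1 with hm
  refine ⟨m, min 1 (B.inf fun w => kpow (PK μ) m 1 w), by omega, ?_, ?_⟩
  · refine lt_min one_pos ?_
    rw [Finset.lt_inf_iff (by simp)]
    intro w hw
    have h1 := path_lower hκ Set.univ (L w) (hL2 w) 1 (by simp)
    rw [QK_univ, hL3, one_mul] at h1
    have h2 : kpow (PK μ) (L w).length 1 w ≠ 0 := by
      intro h0; rw [h0] at h1
      exact (pow_ne_zero _ hκ0.ne') (le_antisymm h1 zero_le)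
    have h3 : (L w).length ≤ m := by
      have := Finset.le_sup (f := fun w => (L w).length) hw
      omega
    exact pos_iff_ne_zero.2 (kpow_lazy _ _ h3 _ _ h2)
  · intro x y hxy
    have e := kpow_left (K := PK μ) (PK_left μ) m x 1 (x⁻¹ * y)
    rw [mul_one, mul_inv_cancel_left] at e
    rw [e]
    refine (min_le_right _ _).trans (Finset.inf_le (f := fun w => kpow (PK μ) m 1 w) ?_)
    simpa [hB, wdist] using hxy

end KernelPart

section AnalysisPart

/-- Cauchy-Schwarz for weights -/
lemma cs_weight {ι : Type*} (k g : ι → ℝ≥0∞) :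
    (∑' i, k i * g i) ^ 2 ≤ (∑' i, k i) * ∑' i, k i * g i ^ 2 := by
  have key : ∀ a b : ℝ≥0∞, 2 * (a * b) ≤ a ^ 2 + b ^ 2 := by
    intro a b
    by_cases ha : a = ⊤
    · simp [ha]
    by_cases hb : b = ⊤
    · simp [hb]
    lift a to NNReal using ha
    lift b to NNReal using hb
    have := two_mul_le_add_sq (a : ℝ) b
    have h2 : 2 * (a * b) ≤ a ^ 2 + b ^ 2 := by
      rw [← NNReal.coe_le_coe]; push_cast; linarith
    exact_mod_cast h2
  have h1 : 2 * (∑' i, k i * g i) ^ 2 ≤ 2 * ((∑' i, k i) * ∑' i, k i * g i ^ 2) := by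
    calc 2 * (∑' i, k i * g i) ^ 2 = ∑' i, ∑' j, k i * k j * (2 * (g i * g j)) := by
          rw [sq]
          simp only [← ENNReal.tsum_mul_left, ← ENNReal.tsum_mul_right]
          refine tsum_congr fun i => tsum_congr fun j => by ring
      _ ≤ ∑' i, ∑' j, k i * k j * (g i ^ 2 + g j ^ 2) := by
          gcongr; exact key _ _
      _ = ∑' i, ∑' j, k j * (k i * g i ^ 2) + ∑' i, ∑' j, k i * (k j * g j ^ 2) := by
          rw [← ENNReal.tsum_add]
          refine tsum_congr fun i => ?_
          rw [← ENNReal.tsum_add]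
          refine tsum_congr fun j => by ring
      _ = 2 * ((∑' i, k i) * ∑' i, k i * g i ^ 2) := by
          simp only [ENNReal.tsum_mul_left, ENNReal.tsum_mul_right]
          ring
  exact (ENNReal.mul_le_mul_iff_right (by simp) (by simp)).1 h1

lemma schur_test {Γ : Type*} (K : Γ → Γ → ℝ≥0∞) (hK : ∀ x y, K x y = K y x) (h : Γ → ℝ≥0∞)
    (h0 : ∀ x, h x ≠ 0) (h1 : ∀ x, h x ≠ ⊤) (lam : ℝ≥0∞)
    (hl : ∀ x, ∑' y, K x y * h y ≤ lam * h x) (f : Γ → ℝ≥0∞) :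
    ∑' x, (∑' y, K x y * f y) ^ 2 ≤ lam ^ 2 * ∑' x, f x ^ 2 := by
  have e1 : ∀ y, h y * (f y / h y) = f y := fun y => ENNReal.mul_div_cancel (h0 y) (h1 y)
  calc ∑' x, (∑' y, K x y * f y) ^ 2 = ∑' x, (∑' y, (K x y * h y) * (f y / h y)) ^ 2 := by
        simp only [mul_assoc, e1]
    _ ≤ ∑' x, (∑' y, K x y * h y) * ∑' y, (K x y * h y) * (f y / h y) ^ 2 := by
        gcongr with x; exact cs_weight _ _
    _ ≤ ∑' x, (lam * h x) * ∑' y, (K x y * h y) * (f y / h y) ^ 2 := by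
        gcongr with x; exact hl x
    _ = lam * ∑' y, (∑' x, K y x * h x) * (f y * (f y / h y)) := by
        rw [← ENNReal.tsum_mul_left]
        simp only [← ENNReal.tsum_mul_left, ← ENNReal.tsum_mul_right]
        rw [ENNReal.tsum_comm]
        refine tsum_congr fun y => tsum_congr fun x => ?_
        rw [hK y x, sq]
        calc lam * h x * (K x y * h y * (f y / h y * (f y / h y)))
            = lam * (K x y * h x * ((h y * (f y / h y)) * (f y / h y))) := by ring
          _ = _ := by rw [e1]
    _ ≤ lam * ∑' y, (lam * h y) * (f y * (f y / h y)) := by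
        gcongr with y; exact hl y
    _ = lam ^ 2 * ∑' x, f x ^ 2 := by
        rw [sq lam, mul_assoc lam lam, ← ENNReal.tsum_mul_left (a := lam) (f := fun x => f x ^ 2)]
        congr 1
        refine tsum_congr fun y => ?_
        calc lam * h y * (f y * (f y / h y)) = lam * (f y * (h y * (f y / h y))) := by ring
          _ = _ := by rw [e1, sq]

/-- contraction for a mixture -/
lemma mix_contract {Γ : Type*} (T A k : Γ → Γ → ℝ≥0∞) (c κ al : ℝ≥0∞)
    (hT : ∀ x y, T x y = c * A x y + k x y)
    (hrow : ∀ x, ∑' y, k x y = κ) (hcol : ∀ y, ∑' x, k x y = κ) (hc : c + κ = 1)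
    (f : Γ → ℝ≥0∞) (hA : ∑' x, (∑' y, A x y * f y) ^ 2 ≤ al * ∑' x, f x ^ 2) :
    ∑' x, (∑' y, T x y * f y) ^ 2 ≤ (c * al + κ) * ∑' x, f x ^ 2 := by
  have pw : ∀ x, (∑' y, T x y * f y) ^ 2 ≤
      c * (∑' y, A x y * f y) ^ 2 + ∑' y, k x y * f y ^ 2 := by
    intro x
    set a := ∑' y, A x y * f y with ha
    set s := ∑' y, k x y * f y with hs
    set t := ∑' y, k x y * f y ^ 2 with ht
    have e : ∑' y, T x y * f y = c * a + s := by
      simp only [hT, add_mul, mul_assoc]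
      rw [ENNReal.tsum_add, ENNReal.tsum_mul_left]
    have key : ∀ a b : ℝ≥0∞, 2 * (a * b) ≤ a ^ 2 + b ^ 2 := by
      intro a b
      by_cases ha : a = ⊤
      · simp [ha]
      by_cases hb : b = ⊤
      · simp [hb]
      lift a to NNReal using ha
      lift b to NNReal using hb
      have := two_mul_le_add_sq (a : ℝ) b
      have h2 : 2 * (a * b) ≤ a ^ 2 + b ^ 2 := by
        rw [← NNReal.coe_le_coe]; push_cast; linarith
      exact_mod_cast h2
    have h1 : s ^ 2 ≤ κ * t := by
      have := cs_weight (fun y => k x y) f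
      rwa [hrow] at this
    have h2 : 2 * (a * s) ≤ κ * a ^ 2 + t := by
      calc 2 * (a * s) = ∑' y, k x y * (2 * (a * f y)) := by
            rw [hs, ← ENNReal.tsum_mul_left, ← ENNReal.tsum_mul_left]
            refine tsum_congr fun y => by ring
        _ ≤ ∑' y, k x y * (a ^ 2 + f y ^ 2) := by gcongr; exact key _ _
        _ = κ * a ^ 2 + t := by
            simp only [mul_add]
            rw [ENNReal.tsum_add, ENNReal.tsum_mul_right, hrow]
    rw [e]
    calc (c * a + s) ^ 2 = c ^ 2 * a ^ 2 + c * (2 * (a * s)) + s ^ 2 := by ring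
      _ ≤ c ^ 2 * a ^ 2 + c * (κ * a ^ 2 + t) + κ * t := by gcongr
      _ = (c + κ) * (c * a ^ 2 + t) := by ring
      _ = _ := by rw [hc, one_mul]
  calc ∑' x, (∑' y, T x y * f y) ^ 2 ≤
      ∑' x, (c * (∑' y, A x y * f y) ^ 2 + ∑' y, k x y * f y ^ 2) := by
        gcongr with x; exact pw x
    _ = c * ∑' x, (∑' y, A x y * f y) ^ 2 + κ * ∑' y, f y ^ 2 := by
        rw [ENNReal.tsum_add, ENNReal.tsum_mul_left]
        congr 1
        rw [ENNReal.tsum_comm]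
        simp only [ENNReal.tsum_mul_right, hcol]
        rw [ENNReal.tsum_mul_left]
    _ ≤ c * (al * ∑' x, f x ^ 2) + κ * ∑' y, f y ^ 2 := by gcongr
    _ = _ := by ring

end AnalysisPart
section SpectralPart

variable {S : Set Γ} {μ : Γ → ℝ}

lemma growth_gap (hS : IsGenSet S) (hne : Nonelementary Γ) {δ : ℝ} (hδ : IsHyperbolic S δ)
    (C : ℕ) : ∃ j : ℕ, 1 ≤ j ∧
      20 * {g : Γ | wl S g ≤ 7 * j + C}.ncard ≤ {g : Γ | wl S g ≤ 8 * j}.ncard := by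
  by_contra hcon
  push Not at hcon
  obtain ⟨N, hN⟩ := exp_growth hS hne hδ
  set b : ℕ → ℕ := fun r => {g : Γ | wl S g ≤ r}.ncard with hb
  have bmono : ∀ r s, r ≤ s → b r ≤ b s := by
    intro r s hrs
    exact Set.ncard_le_ncard (fun g (hg : wl S g ≤ r) => (hg.trans hrs : wl S g ≤ s))
      (ball_finite hS _)
  have hcon' : ∀ j : ℕ, 1 ≤ j → b (8 * j) ≤ 20 * b (7 * j + C) := fun j hj => (hcon j hj).le
  set r0 := 16 * (7 + C) with hr0
  have step : ∀ r, r0 ≤ r → b r ≤ 20 * b (15 * r / 16) := by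
    intro r hr
    calc b r ≤ b (8 * (r / 8 + 1)) := bmono _ _ (by omega)
      _ ≤ 20 * b (7 * (r / 8 + 1) + C) := hcon' _ (by omega)
      _ ≤ 20 * b (15 * r / 16) := by
        have := bmono (7 * (r / 8 + 1) + C) (15 * r / 16) (by omega)
        omega
  have poly : ∀ r, (b r : ℝ) ≤ b r0 * ((r : ℝ) + 1) ^ 100 := by
    intro r
    induction r using Nat.strong_induction_on with
    | _ r ih =>
      by_cases hr : r < r0
      · have h1 : (b r : ℝ) ≤ b r0 := by exact_mod_cast bmono r r0 hr.le
        have h2 : (1 : ℝ) ≤ ((r : ℝ) + 1) ^ 100 := one_le_pow₀ (by linarith [Nat.cast_nonneg (α := ℝ) r])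
        nlinarith [Nat.cast_nonneg (α := ℝ) (b r0)]
      · have hr1 : r0 ≤ r := not_lt.1 hr
        have i := ih (15 * r / 16) (by omega)
        have s : (b r : ℝ) ≤ 20 * b (15 * r / 16) := by exact_mod_cast step r hr1
        have e : ((15 * r / 16 : ℕ) : ℝ) + 1 ≤ 31 / 32 * ((r : ℝ) + 1) := by
          have h1 : 16 * (15 * r / 16) ≤ 15 * r := Nat.mul_div_le _ _
          have h2 : (16 : ℝ) * ((15 * r / 16 : ℕ) : ℝ) ≤ 15 * r := by exact_mod_cast h1
          have h3 : (1 : ℝ) ≤ r := by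
            have : 1 ≤ r := by omega
            exact_mod_cast this
          linarith
        have p : (((15 * r / 16 : ℕ) : ℝ) + 1) ^ 100 ≤ (31 / 32 * ((r : ℝ) + 1)) ^ 100 :=
          pow_le_pow_left₀ (by positivity) e _
        rw [mul_pow] at p
        have q : (20 : ℝ) * (31 / 32) ^ 100 ≤ 1 := by norm_num
        have B0 := Nat.cast_nonneg (α := ℝ) (b r0)
        have W0 : 0 ≤ ((r : ℝ) + 1) ^ 100 :=
          pow_nonneg (add_nonneg (Nat.cast_nonneg _) zero_le_one) _
        generalize ((r : ℝ) + 1) ^ 100 = W at *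
        generalize (((15 * r / 16 : ℕ) : ℝ) + 1) ^ 100 = V at *
        generalize ((31 : ℝ) / 32) ^ 100 = c at *
        generalize (b r0 : ℝ) = B at *
        have k1 : B * V ≤ B * (c * W) := mul_le_mul_of_nonneg_left p B0
        have k2 : (20 * c) * (B * W) ≤ 1 * (B * W) :=
          mul_le_mul_of_nonneg_right q (mul_nonneg B0 W0)
        linarith
  have lim := tendsto_pow_const_div_const_pow_of_one_lt 100 (r := (2 : ℝ)) (by norm_num)
  have lim2 := lim.const_mul ((b r0 : ℝ) * ((N : ℝ) + 1) ^ 100)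
  rw [mul_zero] at lim2
  have ev := (lim2.eventually (gt_mem_nhds (show (0 : ℝ) < 1 by norm_num))).and
    (eventually_ge_atTop 1)
  obtain ⟨k, hk, hk1⟩ := ev.exists
  have h1 : ((2 : ℝ) ^ k) ≤ b (k * N) := by exact_mod_cast hN k
  have h2 := poly (k * N)
  have h3 : ((k * N : ℕ) : ℝ) + 1 ≤ (N + 1) * k := by
    have : (1 : ℝ) ≤ k := by exact_mod_cast hk1
    push_cast; linarith
  have h4 : (((k * N : ℕ) : ℝ) + 1) ^ 100 ≤ ((N + 1) * k) ^ 100 :=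
    pow_le_pow_left₀ (by positivity) h3 _
  rw [mul_pow] at h4
  have h5 : (2 : ℝ) ^ k ≤ b r0 * (((N : ℝ) + 1) ^ 100 * (k : ℝ) ^ 100) :=
    h1.trans (h2.trans (mul_le_mul_of_nonneg_left h4 (Nat.cast_nonneg _)))
  have h6 : (0 : ℝ) < 2 ^ k := by positivity
  rw [← mul_div_assoc, div_lt_one h6] at hk
  linarith

lemma ball_ncard_left (g : Γ) (A : Set Γ) : ((fun x => g * x) '' A).ncard = A.ncard :=
  Set.ncard_image_of_injective A (mul_right_injective g)

/-- real form of the superharmonicity estimate -/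
lemma ball_sum (hS : IsGenSet S) {δ : ℕ} (hδ : IsHyperbolic S (δ : ℝ)) (j : ℕ) (hj : 1 ≤ j)
    (hgap : 20 * {g : Γ | wl S g ≤ 7 * j + 2 * δ}.ncard ≤ {g : Γ | wl S g ≤ 8 * j}.ncard)
    (θ : ℝ) (h0 : 0 < θ) (h1 : θ ≤ 1) (hθ : θ ^ (8 * j) = 1 / 2) (x : Γ) :
    ∑ w ∈ (ball_finite hS (8 * j)).toFinset, θ ^ wl S (x * w) ≤
      19 / 20 * ({g : Γ | wl S g ≤ 8 * j}.ncard : ℝ) * θ ^ wl S x := by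
  classical
  obtain ⟨γ, g0, g1, hγ⟩ := geod_exists hS 1 x⁻¹
  rw [wd_one, wl_inv hS] at hγ
  rw [wd_one, wl_inv hS] at g1
  set y := γ j with hy
  set B7 := {g : Γ | wl S g ≤ 7 * j + 2 * δ} with hB7
  set bad : Set Γ := B7 ∪ (fun z => y * z) '' B7 with hbad
  have fin7 : B7.Finite := ball_finite hS _
  have finbad : bad.Finite := fin7.union (fin7.image _)
  have cbad : (bad.ncard : ℝ) ≤ ({g : Γ | wl S g ≤ 8 * j}.ncard : ℝ) / 10 := by
    have a1 : bad.ncard ≤ B7.ncard + ((fun z => y * z) '' B7).ncard := Set.ncard_union_le _ _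
    rw [ball_ncard_left] at a1
    have a2 : 10 * bad.ncard ≤ {g : Γ | wl S g ≤ 8 * j}.ncard := by omega
    have a3 : (10 : ℝ) * bad.ncard ≤ ({g : Γ | wl S g ≤ 8 * j}.ncard : ℝ) := by exact_mod_cast a2
    linarith
  have hx0 : 0 < θ ^ wl S x := by positivity
  have tau : θ ^ (5 * j) ≤ 71 / 100 := by
    have e1 : θ ^ (5 * j) ≤ θ ^ (4 * j) := pow_le_pow_of_le_one h0.le h1 (by omega)
    have e2 : (θ ^ (4 * j)) ^ 2 = 1 / 2 := by rw [← pow_mul, ← hθ]; congr 1; ring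
    have e3 : 0 < θ ^ (4 * j) := by positivity
    nlinarith
  have good : ∀ w, wl S w ≤ 8 * j → w ∉ bad → wl S x + 5 * j ≤ wl S (x * w) := by
    intro w hw hwb
    simp only [hbad, Set.mem_union, not_or] at hwb
    have w7 : 7 * j + 2 * δ < wl S w := not_le.1 hwb.1
    have gpj : gp S 1 x⁻¹ w ≤ j := by
      by_contra hcon
      push Not at hcon
      apply hwb.2
      refine ⟨y⁻¹ * w, ?_, by simp⟩
      have hjx : (j : ℝ) < wl S x := by
        have := gp_le_left hS 1 x⁻¹ w
        rw [wd_one' hS, wl_inv hS] at this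
        linarith
      have hjx' : j ≤ wl S x := by
        have : j < wl S x := by exact_mod_cast hjx
        omega
      have ly : wl S y = j := by
        have := hγ 0 j (by omega) hjx'
        rw [g0, wd_one] at this; simpa using this
      have dy : wdist S y x⁻¹ = wl S x - j := by
        have := hγ j (wl S x) hjx' le_rfl
        rwa [g1] at this
      have gy : gp S 1 y x⁻¹ = j := by
        rw [gp_one hS, ly, wl_inv hS]
        have : wl S (y⁻¹ * x⁻¹) = wl S x - j := dy
        rw [this, Nat.cast_sub hjx']; ring
      have e1 : (j : ℝ) - δ ≤ gp S 1 y w := by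
        rcases hyp4 hδ hS 1 y w x⁻¹ with h | h <;> linarith
      have e2 := gp_one hS y w
      rw [ly] at e2
      have e3 : (wl S w : ℝ) ≤ 8 * j := by exact_mod_cast hw
      have e4 : (wl S (y⁻¹ * w) : ℝ) ≤ 7 * j + 2 * δ := by linarith
      have e5 : wl S (y⁻¹ * w) ≤ 7 * j + 2 * δ := by exact_mod_cast e4
      exact e5
    have L := wl_mul_eq hS x w
    have w7' : (7 : ℝ) * j + 2 * δ < wl S w := by exact_mod_cast w7
    have : (wl S x : ℝ) + 5 * j ≤ wl S (x * w) := by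
      have := Nat.cast_nonneg (α := ℝ) δ
      linarith
    exact_mod_cast this
  have term : ∀ w ∈ (ball_finite hS (8 * j)).toFinset, θ ^ wl S (x * w) ≤
      (71 / 100 + (if w ∈ bad then 2 else 0)) * θ ^ wl S x := by
    intro w hw
    have hw' : wl S w ≤ 8 * j := by simpa using hw
    by_cases hb : w ∈ bad
    · rw [if_pos hb]
      have t : wl S x ≤ wl S (x * w) + 8 * j := by
        have := wl_mul_le hS (x * w) w⁻¹
        rw [mul_inv_cancel_right, wl_inv hS] at this
        omega
      have e1 : θ ^ (wl S (x * w) + 8 * j) ≤ θ ^ wl S x := pow_le_pow_of_le_one h0.le h1 t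
      rw [pow_add, hθ] at e1
      nlinarith
    · rw [if_neg hb, add_zero]
      have e1 := pow_le_pow_of_le_one h0.le h1 (good w hw' hb)
      rw [pow_add] at e1
      nlinarith
  refine (Finset.sum_le_sum term).trans ?_
  rw [← Finset.sum_mul, Finset.sum_add_distrib, Finset.sum_const, ← Finset.sum_filter,
    Finset.sum_const, nsmul_eq_mul, nsmul_eq_mul]
  have c1 : ((ball_finite hS (8 * j)).toFinset.card) = {g : Γ | wl S g ≤ 8 * j}.ncard :=
    (Set.ncard_eq_toFinset_card _ _).symm
  have c2 : ((ball_finite hS (8 * j)).toFinset.filter (· ∈ bad)).card ≤ bad.ncard := by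
    rw [← Set.ncard_coe_finset]
    refine Set.ncard_le_ncard ?_ finbad
    intro w hw
    simp only [Finset.coe_filter, Set.mem_ofPred_eq] at hw
    exact hw.2
  have c3 : (((ball_finite hS (8 * j)).toFinset.filter (· ∈ bad)).card : ℝ) ≤ bad.ncard := by
    exact_mod_cast c2
  rw [c1]
  have c4 := Nat.cast_nonneg (α := ℝ) ({g : Γ | wl S g ≤ 8 * j}.ncard)
  refine mul_le_mul_of_nonneg_right ?_ hx0.le
  linarith

end SpectralPart
section DecayPart

variable {S : Set Γ} {μ : Γ → ℝ}

open Classical in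
/-- normalised ball kernel -/
noncomputable def AK (S : Set Γ) (K : ℕ) (x y : Γ) : ℝ≥0∞ :=
  if wdist S x y ≤ K then ({g : Γ | wl S g ≤ K}.ncard : ℝ≥0∞)⁻¹ else 0

lemma AK_sum (hS : IsGenSet S) (K : ℕ) (x : Γ) (f : Γ → ℝ≥0∞) :
    ∑' y, AK S K x y * f y = ({g : Γ | wl S g ≤ K}.ncard : ℝ≥0∞)⁻¹ *
      ∑ w ∈ (ball_finite hS K).toFinset, f (x * w) := by
  rw [← (Equiv.mulLeft x).tsum_eq]
  rw [tsum_eq_sum (s := (ball_finite hS K).toFinset)]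
  · rw [Finset.mul_sum]
    refine Finset.sum_congr rfl fun w hw => ?_
    have : wl S w ≤ K := by simpa using hw
    simp [AK, wdist, this]
  · intro w hw
    have : ¬ wl S w ≤ K := by simpa using hw
    simp [AK, wdist, this]

lemma ball_ncard_pos (hS : IsGenSet S) (K : ℕ) : 0 < {g : Γ | wl S g ≤ K}.ncard := by
  rw [Set.ncard_pos (ball_finite hS K)]
  exact ⟨1, by simp [wl_one]⟩

lemma AK_row (hS : IsGenSet S) (K : ℕ) (x : Γ) : ∑' y, AK S K x y = 1 := by
  have := AK_sum hS K x (fun _ => 1)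
  simp only [mul_one] at this
  rw [this, Finset.sum_const, nsmul_eq_mul, mul_one,
    ← Set.ncard_eq_toFinset_card _ (ball_finite hS K)]
  refine ENNReal.inv_mul_cancel ?_ (by simp)
  exact_mod_cast (ball_ncard_pos hS K).ne'

lemma AK_symm (hS : IsGenSet S) (K : ℕ) (x y : Γ) : AK S K x y = AK S K y x := by
  unfold AK; rw [wd_comm hS]

lemma AK_contract (hS : IsGenSet S) (hne : Nonelementary Γ) {δ : ℕ}
    (hδ : IsHyperbolic S (δ : ℝ)) :
    ∃ K : ℕ, ∀ f : Γ → ℝ≥0∞, ∑' x, (∑' y, AK S K x y * f y) ^ 2 ≤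
      (ENNReal.ofReal (19 / 20)) ^ 2 * ∑' x, f x ^ 2 := by
  obtain ⟨j, hj, hgap⟩ := growth_gap hS hne hδ (2 * δ)
  set θ : ℝ := (1 / 2 : ℝ) ^ ((1 : ℝ) / ((8 * j : ℕ) : ℝ)) with hθdef
  have h0 : 0 < θ := by positivity
  have h1 : θ ≤ 1 := Real.rpow_le_one (by norm_num) (by norm_num) (by positivity)
  have hθ : θ ^ (8 * j) = 1 / 2 := by
    rw [hθdef, ← Real.rpow_natCast, ← Real.rpow_mul (by norm_num), one_div_mul_cancel, Real.rpow_one]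
    have : 8 * j ≠ 0 := by omega
    exact_mod_cast this
  refine ⟨8 * j, fun f => ?_⟩
  refine schur_test (AK S (8 * j)) (AK_symm hS _) (fun x => ENNReal.ofReal (θ ^ wl S x)) ?_ ?_ _ ?_ f
  · intro x; simp; positivity
  · intro x; simp
  · intro x
    rw [AK_sum hS, ← ENNReal.ofReal_sum_of_nonneg (fun _ _ => by positivity)]
    have hb := ball_sum hS hδ j hj hgap θ h0 h1 hθ x
    set b := {g : Γ | wl S g ≤ 8 * j}.ncard with hbdef
    have bpos : (0 : ℝ) < b := by exact_mod_cast ball_ncard_pos hS (8 * j)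
    rw [← ENNReal.ofReal_natCast b, ← ENNReal.ofReal_inv_of_pos bpos,
      ← ENNReal.ofReal_mul (by positivity), ← ENNReal.ofReal_mul (by positivity)]
    refine ENNReal.ofReal_le_ofReal ?_
    calc (b : ℝ)⁻¹ * _ ≤ (b : ℝ)⁻¹ * (19 / 20 * (b : ℝ) * θ ^ wl S x) := by gcongr
      _ = _ := by field_simp

lemma P_contract (hS : IsGenSet S) (hne : Nonelementary Γ) {δ : ℕ}
    (hδ : IsHyperbolic S (δ : ℝ)) (hμ : IsRWMeasure S μ) :
    ∃ (m : ℕ) (η : ℝ≥0∞), 1 ≤ m ∧ η < 1 ∧ ∀ f : Γ → ℝ≥0∞,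
      ∑' x, (∑' y, kpow (PK μ) m x y * f y) ^ 2 ≤ η * ∑' x, f x ^ 2 := by
  obtain ⟨K, hK⟩ := AK_contract hS hne hδ
  obtain ⟨m, c, hm, hc, hmin⟩ := minorize hS hμ K
  set b := {g : Γ | wl S g ≤ K}.ncard with hbdef
  have bpos : (b : ℝ≥0∞) ≠ 0 := by exact_mod_cast (ball_ncard_pos hS K).ne'
  set c' : ℝ≥0∞ := c * b with hc'
  have hle : ∀ x y, c' * AK S K x y ≤ kpow (PK μ) m x y := by
    intro x y
    unfold AK
    split_ifs with h
    · rw [hc', mul_assoc, ENNReal.mul_inv_cancel bpos (by simp), mul_one]; exact hmin x y h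
    · simp
  set k : Γ → Γ → ℝ≥0∞ := fun x y => kpow (PK μ) m x y - c' * AK S K x y with hk
  have hT : ∀ x y, kpow (PK μ) m x y = c' * AK S K x y + k x y := fun x y =>
    (add_tsub_cancel_of_le (hle x y)).symm
  have row : ∀ x, c' + ∑' y, k x y = 1 := by
    intro x
    have := kpow_row (PK_row hμ) m x
    simp only [hT] at this
    rwa [ENNReal.tsum_add, ENNReal.tsum_mul_left, AK_row hS, mul_one] at this
  have col : ∀ y, c' + ∑' x, k x y = 1 := by
    intro y
    have := kpow_col (PK_col hμ) m y
    simp only [hT] at this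
    rw [ENNReal.tsum_add, ENNReal.tsum_mul_left] at this
    simp only [AK_symm hS K _ y] at this
    rwa [AK_row hS, mul_one] at this
  have c1 : c' ≤ 1 := by rw [← row 1]; exact le_self_add
  have ctop : c' ≠ ⊤ := ne_top_of_le_ne_top ENNReal.one_ne_top c1
  have cpos : c' ≠ 0 := mul_ne_zero hc.ne' bpos
  have row' : ∀ x, ∑' y, k x y = 1 - c' := fun x => ENNReal.eq_sub_of_add_eq ctop (by rw [add_comm]; exact row x)
  have col' : ∀ y, ∑' x, k x y = 1 - c' := fun x => ENNReal.eq_sub_of_add_eq ctop (by rw [add_comm]; exact col x)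
  have hcc : c' + (1 - c') = 1 := add_tsub_cancel_of_le c1
  refine ⟨m, c' * (ENNReal.ofReal (19 / 20)) ^ 2 + (1 - c'), hm, ?_, fun f => ?_⟩
  · conv_rhs => rw [← hcc]
    refine ENNReal.add_lt_add_right (ne_top_of_le_ne_top ENNReal.one_ne_top tsub_le_self) ?_
    conv_rhs => rw [← mul_one c']
    refine ENNReal.mul_lt_mul_right cpos ctop ?_
    rw [← ENNReal.ofReal_pow (by norm_num), ← ENNReal.ofReal_one]
    exact (ENNReal.ofReal_lt_ofReal_iff one_pos).2 (by norm_num)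
  · exact mix_contract _ (AK S K) k c' (1 - c') _ hT row' col' hcc f (hK f)

lemma P_nonexp (hμ : IsRWMeasure S μ) (f : Γ → ℝ≥0∞) :
    ∑' x, (∑' y, PK μ x y * f y) ^ 2 ≤ ∑' x, f x ^ 2 := by
  have := mix_contract (PK μ) (fun _ _ => 0) (PK μ) 0 1 0 (by simp) (PK_row hμ) (PK_col hμ)
    (by simp) f (by simp)
  simpa using this

/-- exponential decay of the transition probabilities -/
lemma P_decay (hS : IsGenSet S) (hne : Nonelementary Γ) {δ : ℕ}
    (hδ : IsHyperbolic S (δ : ℝ)) (hμ : IsRWMeasure S μ) :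
    ∃ (ρ C : ℝ≥0∞), 0 < ρ ∧ ρ < 1 ∧ C ≠ ⊤ ∧ ∀ (n : ℕ) (x z : Γ), kpow (PK μ) n x z ≤ C * ρ ^ n := by
  obtain ⟨m, η, hm, hη, hcon⟩ := P_contract hS hne hδ hμ
  -- choose ρ with ρ^(2m) ≥ η
  obtain ⟨ρ, hρ0, hρ1, hρ⟩ : ∃ ρ : ℝ≥0∞, 0 < ρ ∧ ρ < 1 ∧ η ≤ ρ ^ (2 * m) := by
    set e : ℝ := max η.toReal (1 / 2) with he
    have e0 : 0 < e := lt_max_of_lt_right (by norm_num)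
    have e1 : e < 1 := max_lt (by
      rw [← ENNReal.toReal_one]
      exact (ENNReal.toReal_lt_toReal hη.ne_top ENNReal.one_ne_top).2 hη) (by norm_num)
    have m0 : ((2 * m : ℕ) : ℝ) ≠ 0 := by
      have : 2 * m ≠ 0 := by omega
      exact_mod_cast this
    refine ⟨ENNReal.ofReal (e ^ ((1 : ℝ) / ((2 * m : ℕ) : ℝ))), ?_, ?_, ?_⟩
    · rw [ENNReal.ofReal_pos]; positivity
    · rw [← ENNReal.ofReal_one]
      refine (ENNReal.ofReal_lt_ofReal_iff one_pos).2 ?_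
      exact Real.rpow_lt_one e0.le e1 (by positivity)
    · rw [← ENNReal.ofReal_pow (by positivity), ← Real.rpow_natCast, ← Real.rpow_mul e0.le,
        one_div_mul_cancel m0, Real.rpow_one]
      rw [ENNReal.le_ofReal_iff_toReal_le hη.ne_top e0.le]
      exact le_max_left _ _
  have hρt : ρ ≠ ⊤ := hρ1.ne_top
  have norm0 : ∀ z : Γ, ∑' x, (kpow (PK μ) 0 x z) ^ 2 ≤ 1 := by
    intro z
    simp only [kpow_zero, sq]
    rw [tsum_kone_right z (fun y => kone y z)]
    simp [kone]
  have normstep : ∀ (n : ℕ) (z : Γ), ∑' x, (kpow (PK μ) (n + 1) x z) ^ 2 ≤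
      ∑' x, (kpow (PK μ) n x z) ^ 2 := fun n z => P_nonexp hμ (fun y => kpow (PK μ) n y z)
  have norm1 : ∀ (n : ℕ) (z : Γ), ∑' x, (kpow (PK μ) n x z) ^ 2 ≤ 1 := by
    intro n z
    induction n with
    | zero => exact norm0 z
    | succ n ih => exact (normstep n z).trans ih
  have normm : ∀ (q r : ℕ) (z : Γ), ∑' x, (kpow (PK μ) (m * q + r) x z) ^ 2 ≤ ρ ^ (2 * m * q) := by
    intro q r z
    induction q with
    | zero => simpa using norm1 r z
    | succ q ih =>
      have e : m * (q + 1) + r = m + (m * q + r) := by ring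
      rw [e]
      simp only [kpow_add (PK μ) m (m * q + r)]
      refine (hcon _).trans ?_
      rw [show 2 * m * (q + 1) = 2 * m + 2 * m * q by ring, pow_add]
      exact mul_le_mul' hρ ih
  refine ⟨ρ, (ρ ^ m)⁻¹, hρ0, hρ1, by simp [hρ0.ne'], fun n x z => ?_⟩
  have h1 : (kpow (PK μ) n x z) ^ 2 ≤ ρ ^ (2 * m * (n / m)) := by
    have := normm (n / m) (n % m) z
    rw [Nat.div_add_mod] at this
    exact (ENNReal.le_tsum x).trans this
  have h2 : ρ ^ (2 * m * (n / m)) = (ρ ^ (m * (n / m))) ^ 2 := by rw [← pow_mul]; congr 1; ring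
  rw [h2] at h1
  have h3 : kpow (PK μ) n x z ≤ ρ ^ (m * (n / m)) := (ENNReal.pow_le_pow_left_iff two_ne_zero).1 h1
  refine h3.trans ?_
  have h4 : ρ ^ m * ρ ^ (m * (n / m)) ≤ ρ ^ n := by
    rw [← pow_add]
    refine pow_le_pow_of_le_one zero_le hρ1.le ?_
    have a := Nat.div_add_mod n m
    have b := Nat.mod_lt n (show 0 < m by omega)
    omega
  calc ρ ^ (m * (n / m)) = (ρ ^ m)⁻¹ * (ρ ^ m * ρ ^ (m * (n / m))) := by
        rw [← mul_assoc, ENNReal.inv_mul_cancel (pow_ne_zero _ hρ0.ne') (ENNReal.pow_ne_top hρt),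
          one_mul]
    _ ≤ _ := by gcongr

end DecayPart
section GreenPart

variable {S : Set Γ} {μ : Γ → ℝ}

/-- Green kernel of the walk restricted to `D` -/
noncomputable def GK (μ : Γ → ℝ) (D : Set Γ) (x z : Γ) : ℝ≥0∞ := ∑' n, kpow (QK μ D) n x z

lemma GK_left (D : Set Γ) (x z : Γ) :
    GK μ D x z = kone x z + ∑' y, QK μ D x y * GK μ D y z := by
  unfold GK
  rw [tsum_eq_zero_add' ENNReal.summable]
  simp only [← ENNReal.tsum_mul_left]
  rw [ENNReal.tsum_comm]
  rfl

lemma GK_right (D : Set Γ) (x z : Γ) :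
    GK μ D x z = kone x z + ∑' y, GK μ D x y * QK μ D y z := by
  unfold GK
  rw [tsum_eq_zero_add' ENNReal.summable]
  simp only [← ENNReal.tsum_mul_right]
  rw [ENNReal.tsum_comm]
  simp only [kpow_succ']
  rfl

lemma GK_super (D E : Set Γ) (h : D ⊆ E) (x z : Γ) :
    ∑' y, QK μ D x y * GK μ E y z ≤ GK μ E x z := by
  rw [GK_left E x z]
  refine le_trans ?_ le_add_self
  gcongr with y
  exact QK_mono h x y

lemma GK_super_right (D : Set Γ) (x z : Γ) :
    ∑' y, GK μ D x y * QK μ D y z ≤ GK μ D x z := by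
  conv_rhs => rw [GK_right D x z]
  exact le_add_self

lemma kpow_QK_mem {D : Set Γ} {n : ℕ} {x z : Γ} (h : kpow (QK μ D) n x z ≠ 0) :
    (x ∈ D ↔ z ∈ D) := by
  induction n generalizing x with
  | zero =>
    have : x = z := by
      by_contra hxz; apply h; simp [kpow_zero, kone, hxz]
    rw [this]
  | succ n ih =>
    rw [kpow_succ] at h
    simp only [ne_eq, ENNReal.tsum_eq_zero, not_forall] at h
    obtain ⟨y, hy⟩ := h
    have h2 := ih (right_ne_zero_of_mul hy)
    have h1 := left_ne_zero_of_mul hy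
    have h3 : x ∈ D ∧ y ∈ D := by
      by_contra hc; apply h1; simp [QK, hc]
    tauto

/-- comparison principle -/
lemma lemM {D E : Set Γ} (hE : E ⊆ D) (z : Γ) (ψ : Γ → ℝ≥0∞)
    (hψ : ∀ x ∈ E, ∑' y, QK μ D x y * ψ y ≤ ψ x)
    (hb : ∀ x ∈ D, x ∉ E → GK μ D x z ≤ ψ x) (x : Γ) (hx : x ∈ D) :
    GK μ D x z ≤ ψ x + GK μ E x z := by
  have main : ∀ N : ℕ, ∀ x ∈ D, ∑ n ∈ Finset.range N, kpow (QK μ D) n x z ≤ ψ x + GK μ E x z := by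
    intro N
    induction N with
    | zero => intro x _; simp
    | succ N ih =>
      intro x hx
      by_cases hxE : x ∈ E
      · rw [Finset.sum_range_succ']
        have e1 : ∑ n ∈ Finset.range N, kpow (QK μ D) (n + 1) x z =
            ∑' y, QK μ D x y * ∑ n ∈ Finset.range N, kpow (QK μ D) n y z := by
          simp only [Finset.mul_sum, kpow_succ]
          rw [Summable.tsum_finsetSum (fun _ _ => ENNReal.summable)]
        have e2 : ∑' y, QK μ D x y * ∑ n ∈ Finset.range N, kpow (QK μ D) n y z ≤
            ∑' y, (QK μ D x y * ψ y + QK μ E x y * GK μ E y z) := by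
          refine ENNReal.tsum_le_tsum fun y => ?_
          by_cases hy : y ∈ E
          · rw [QK_of_mem hxE hy, QK_of_mem hx (hE hy), ← mul_add]
            gcongr
            exact ih y (hE hy)
          · by_cases hyD : y ∈ D
            · refine le_trans ?_ le_self_add
              gcongr
              exact (ENNReal.sum_le_tsum _).trans (hb y hyD hy)
            · have : QK μ D x y = 0 := by simp [QK, hyD]
              simp [this]
        rw [ENNReal.tsum_add] at e2
        rw [e1, GK_left E x z, kpow_zero]
        calc _ ≤ (∑' y, QK μ D x y * ψ y + ∑' y, QK μ E x y * GK μ E y z) + kone x z := by gcongr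
          _ ≤ (ψ x + ∑' y, QK μ E x y * GK μ E y z) + kone x z := by gcongr; exact hψ x hxE
          _ = _ := by ring
      · exact (ENNReal.sum_le_tsum _).trans ((hb x hx hxE).trans le_self_add)
  unfold GK at *
  rw [ENNReal.tsum_eq_iSup_nat]
  exact iSup_le fun N => main N x hx

lemma kone_symm (x y : Γ) : kone x y = kone y x := by
  unfold kone
  by_cases h : x = y
  · simp [h]
  · rw [if_neg h, if_neg (Ne.symm h)]

/-- reflected measure -/
def refl (μ : Γ → ℝ) (g : Γ) : ℝ := μ g⁻¹

lemma PK_refl (x y : Γ) : PK (refl μ) x y = PK μ y x := by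
  unfold PK refl
  congr 2
  · exact kone_symm x y
  · simp

lemma QK_refl (D : Set Γ) (x y : Γ) : QK (refl μ) D x y = QK μ D y x := by
  unfold QK
  rw [PK_refl]
  by_cases hx : x ∈ D <;> by_cases hy : y ∈ D <;> simp [hx, hy]

lemma kpow_refl (D : Set Γ) (n : ℕ) (x z : Γ) : kpow (QK (refl μ) D) n x z = kpow (QK μ D) n z x := by
  induction n generalizing x with
  | zero => exact kone_symm x z
  | succ n ih =>
    rw [kpow_succ, kpow_succ']
    simp only [ih, QK_refl]
    exact tsum_congr fun y => mul_comm _ _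

lemma GK_refl (D : Set Γ) (x z : Γ) : GK (refl μ) D x z = GK μ D z x := by
  unfold GK; simp only [kpow_refl]

lemma lemM' {D E : Set Γ} (hE : E ⊆ D) (x : Γ) (ψ : Γ → ℝ≥0∞)
    (hψ : ∀ z ∈ E, ∑' y, ψ y * QK μ D y z ≤ ψ z)
    (hb : ∀ z ∈ D, z ∉ E → GK μ D x z ≤ ψ z) (z : Γ) (hz : z ∈ D) :
    GK μ D x z ≤ ψ z + GK μ E x z := by
  have := lemM (μ := refl μ) hE x ψ (by
    intro z hz
    simp only [QK_refl]
    refine le_trans (le_of_eq ?_) (hψ z hz)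
    exact tsum_congr fun y => mul_comm _ _) (by
    intro z hz hzE; rw [GK_refl]; exact hb z hz hzE) z hz
  rwa [GK_refl, GK_refl] at this

lemma diverge (hS : IsGenSet S) (hμ : IsRWMeasure S μ) {δ : ℝ} (hδ : IsHyperbolic S δ)
    (b : Γ) (r : ℕ) (E : Set Γ) (hE : ∀ y ∈ E, r ≤ wdist S y b) (k : ℕ) :
    ∀ (l : ℕ) (x z : Γ), x ∈ E → l ≤ 2 ^ k → kpow (QK μ E) l x z ≠ 0 →
      (r : ℝ) - 1 - k * δ ≤ gp S b x z := by
  induction k with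
  | zero =>
    intro l x z hx hl h
    have hz := (kpow_QK_mem h).1 hx
    have h1 : kpow (PK μ) l x z ≠ 0 := by
      intro h0; apply h
      exact le_antisymm ((kpow_mono (QK_le E) l x z).trans h0.le) zero_le
    have h2 := kpow_near hS hμ l h1
    have h3 : (wdist S x z : ℝ) ≤ 1 := by
      have : wdist S x z ≤ 1 := h2.trans (by simpa using hl)
      exact_mod_cast this
    have h4 : (r : ℝ) ≤ wdist S x b := by exact_mod_cast hE x hx
    have h5 : (r : ℝ) ≤ wdist S z b := by exact_mod_cast hE z hz
    unfold gp; push_cast; linarith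
  | succ k ih =>
    intro l x z hx hl h
    have hz := (kpow_QK_mem h).1 hx
    have e : l = l / 2 + (l - l / 2) := by omega
    rw [e, kpow_add] at h
    simp only [ne_eq, ENNReal.tsum_eq_zero, not_forall] at h
    obtain ⟨y, hy⟩ := h
    rw [pow_succ] at hl
    have h1 := left_ne_zero_of_mul hy
    have h2 := right_ne_zero_of_mul hy
    have hyE := (kpow_QK_mem h1).1 hx
    have i1 := ih _ x y hx (by omega) h1
    have i2 := ih _ y z hyE (by omega) h2
    push_cast
    rcases hyp4 hδ hS b x z y with h | h <;> linarith

/-- decay hypothesis for the walk -/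
structure Decay (μ : Γ → ℝ) (ρ C : ℝ≥0∞) : Prop where
  rpos : 0 < ρ
  rlt : ρ < 1
  ctop : C ≠ ⊤
  bound : ∀ (D : Set Γ) (x z : Γ), GK μ D x z ≤ C
  tail : ∀ (D : Set Γ) (x z : Γ) (L : ℕ), ∑' n, kpow (QK μ D) (n + L) x z ≤ C * ρ ^ L
  single : ∀ (n : ℕ) (x z : Γ), kpow (PK μ) n x z ≤ C * ρ ^ n

lemma decay_exists (hS : IsGenSet S) (hne : Nonelementary Γ) {δ : ℕ}
    (hδ : IsHyperbolic S (δ : ℝ)) (hμ : IsRWMeasure S μ) : ∃ ρ C : ℝ≥0∞, Decay μ ρ C := by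
  obtain ⟨ρ, C, h0, h1, hC, h⟩ := P_decay hS hne hδ hμ
  have hb : ∀ (D : Set Γ) (n : ℕ) (x z : Γ), kpow (QK μ D) n x z ≤ C * ρ ^ n := fun D n x z =>
    (kpow_mono (QK_le D) n x z).trans (h n x z)
  have ht : (1 - ρ)⁻¹ ≠ ⊤ := by
    simp only [ne_eq, ENNReal.inv_eq_top]
    exact (tsub_pos_of_lt h1).ne'
  have h1' : 1 ≤ (1 - ρ)⁻¹ := by
    rw [ENNReal.one_le_inv]; exact tsub_le_self
  have tail : ∀ (D : Set Γ) (x z : Γ) (L : ℕ),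
      ∑' n, kpow (QK μ D) (n + L) x z ≤ (C * (1 - ρ)⁻¹) * ρ ^ L := by
    intro D x z L
    calc ∑' n, kpow (QK μ D) (n + L) x z ≤ ∑' n, C * ρ ^ (n + L) := by gcongr; exact hb _ _ _ _
      _ = _ := by
        simp only [pow_add, ← mul_assoc]
        rw [ENNReal.tsum_mul_right, ENNReal.tsum_mul_left, ENNReal.tsum_geometric]
  refine ⟨ρ, C * (1 - ρ)⁻¹, h0, h1, ENNReal.mul_ne_top hC ht, ?_, tail, ?_⟩
  · intro D x z
    have := tail D x z 0
    simp only [add_zero, pow_zero, mul_one] at this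
    exact this
  · intro n x z
    refine (h n x z).trans ?_
    gcongr
    exact le_mul_of_one_le_right zero_le h1'

lemma tsum_split (f : ℕ → ℝ≥0∞) (L : ℕ) (h : ∀ n < L, f n = 0) : ∑' n, f n = ∑' n, f (n + L) := by
  induction L with
  | zero => simp
  | succ L ih =>
    rw [ih (fun n hn => h n (by omega))]
    rw [tsum_eq_zero_add' ENNReal.summable]
    rw [zero_add, h L (by omega), zero_add]
    refine tsum_congr (fun n => ?_)
    congr 1
    omega

lemma tail_bound (hS : IsGenSet S) (hμ : IsRWMeasure S μ) {δ : ℕ} (hδ : IsHyperbolic S (δ : ℝ))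
    {ρ C : ℝ≥0∞} (hd : Decay μ ρ C) (b : Γ) (k r : ℕ) (hr : (k + 2) * δ + 2 ≤ r) (E : Set Γ)
    (hE : ∀ y ∈ E, r ≤ wdist S y b) (x z : Γ) (hxz : x ∈ E ∨ z ∈ E)
    (hgp : gp S b x z ≤ 2 * δ) : GK μ E x z ≤ C * ρ ^ (2 ^ k) := by
  have hz : ∀ n < 2 ^ k, kpow (QK μ E) n x z = 0 := by
    intro n hn
    by_contra hne
    have hx : x ∈ E := by
      have := kpow_QK_mem hne
      tauto
    have := diverge hS hμ hδ b r E hE k n x z hx hn.le hne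
    have hr' : ((k : ℝ) + 2) * δ + 2 ≤ r := by exact_mod_cast hr
    linarith
  have key : ∀ L : ℕ, (∀ n < L, kpow (QK μ E) n x z = 0) → GK μ E x z ≤ C * ρ ^ L := by
    intro L hL
    unfold GK
    rw [tsum_split _ L hL]
    exact hd.tail E x z L
  exact key _ hz

end GreenPart
section AnconaPart

variable {S : Set Γ} {μ : Γ → ℝ}

lemma gate_gp (hS : IsGenSet S) {δ : ℕ} (hδ : IsHyperbolic S (δ : ℝ)) {γ : ℕ → Γ} {n : ℕ}
    (hγ : ∀ i j : ℕ, i ≤ j → j ≤ n → wdist S (γ i) (γ j) = j - i) {s t s' : ℕ} (h1 : s ≤ t)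
    (h2 : t ≤ s') (h3 : s' ≤ n) {x z : Γ} (hx : x = γ s ∨ wdist S x (γ s) + 2 * δ < t - s)
    (hz : z = γ s' ∨ wdist S z (γ s') + 2 * δ < s' - t) : gp S (γ t) x z ≤ 2 * δ := by
  have e1 : wdist S (γ s) (γ t) = t - s := hγ s t h1 (h2.trans h3)
  have e2 : wdist S (γ s') (γ t) = s' - t := by rw [wd_comm hS]; exact hγ t s' h2 h3
  have e3 : wdist S (γ s) (γ s') = s' - s := hγ s s' (h1.trans h2) h3
  have h0 : gp S (γ t) (γ s) (γ s') = 0 := by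
    unfold gp
    rw [e1, e2, e3]
    push_cast [Nat.cast_sub h1, Nat.cast_sub h2, Nat.cast_sub (h1.trans h2)]
    ring
  have hδ0 : (0 : ℝ) ≤ δ := by positivity
  by_contra hc
  push Not at hc
  have k1 : (δ : ℝ) < gp S (γ t) (γ s) z := by
    rcases hx with rfl | hx
    · linarith
    · rcases hyp4 hδ hS (γ t) (γ s) z x with h | h
      · have l := gp_lip hS (γ t) (γ s) x (γ s)
        rw [gp_self, e1, gp_comm hS, wd_comm hS] at l
        have : ((wdist S x (γ s) + 2 * δ : ℕ) : ℝ) < ((t - s : ℕ) : ℝ) := by exact_mod_cast hx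
        push_cast at this
        linarith
      · linarith
  rcases hz with rfl | hz
  · linarith
  · rcases hyp4 hδ hS (γ t) (γ s) (γ s') z with h | h
    · linarith
    · have l := gp_lip hS (γ t) (γ s') z (γ s')
      rw [gp_self, e2, wd_comm hS] at l
      have : ((wdist S z (γ s') + 2 * δ : ℕ) : ℝ) < ((s' - t : ℕ) : ℝ) := by exact_mod_cast hz
      push_cast at this
      linarith

lemma lin_le_two_pow (A B : ℕ) : ∃ j : ℕ, A * j + B ≤ 2 ^ j := by
  refine ⟨2 * (2 * A + B), ?_⟩
  set m := 2 * A + B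
  have h : m + 1 ≤ 2 ^ m := Nat.lt_two_pow_self
  have : 2 ^ (2 * m) = 2 ^ m * 2 ^ m := by rw [two_mul, pow_add]
  rw [this]
  have h2 : (m + 1) * (m + 1) ≤ 2 ^ m * 2 ^ m := Nat.mul_le_mul h h
  have hA : A * (2 * m) ≤ m * m := by
    have : 2 * A ≤ m := by omega
    nlinarith
  have hB : B ≤ m := by omega
  nlinarith

lemma exists_q {ρ C κ : ℝ≥0∞} (hd : Decay μ ρ C) (hκ : 0 < κ) :
    ∃ q : ℕ, ρ ^ q ≤ κ ∧ ρ ^ q ≤ 2⁻¹ ∧ C * ρ ^ q ≤ 1 := by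
  have ht := ENNReal.tendsto_pow_atTop_nhds_zero_of_lt_one hd.rlt
  have h1 := ht.eventually (Iio_mem_nhds hκ)
  have h2 := ht.eventually (Iio_mem_nhds (show (0 : ℝ≥0∞) < 2⁻¹ by simp))
  have h3 := ht.eventually (Iio_mem_nhds (show (0 : ℝ≥0∞) < C⁻¹ by simpa using hd.ctop))
  obtain ⟨q, ⟨a1, a2⟩, a3⟩ := ((h1.and h2).and h3).exists
  refine ⟨q, le_of_lt a1, le_of_lt a2, ?_⟩
  calc C * ρ ^ q ≤ C * C⁻¹ := by gcongr
    _ ≤ 1 := ENNReal.mul_inv_le_one C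

lemma err_bound {ρ C κ : ℝ≥0∞} (hd : Decay μ ρ C) {q : ℕ} (h1 : ρ ^ q ≤ κ)
    (h2 : ρ ^ q ≤ 2⁻¹) (h3 : C * ρ ^ q ≤ 1) {N i e : ℕ} (hN : q * (1 + i + e) ≤ N) :
    C * ρ ^ N ≤ 2⁻¹ ^ i * κ ^ e := by
  have hr : ρ ≤ 1 := hd.rlt.le
  calc C * ρ ^ N ≤ C * ρ ^ (q * (1 + i + e)) := by
        gcongr 1
        exact pow_le_pow_right_of_le_one' hr hN
    _ = (C * ρ ^ q) * (ρ ^ q) ^ i * (ρ ^ q) ^ e := by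
        rw [mul_add, mul_add, mul_one, pow_add, pow_add, pow_mul, pow_mul]; ring
    _ ≤ 1 * 2⁻¹ ^ i * κ ^ e := by gcongr
    _ = _ := by rw [one_mul]

lemma step_err (hS : IsGenSet S) (hμ : IsRWMeasure S μ) {δ : ℕ} (hδ : IsHyperbolic S (δ : ℝ))
    {ρ C κ : ℝ≥0∞} (hd : Decay μ ρ C) (hκ1 : κ ≤ 1) {q : ℕ} (h1 : ρ ^ q ≤ κ)
    (h2 : ρ ^ q ≤ 2⁻¹) (h3 : C * ρ ^ q ≤ 1) {M j : ℕ} (hj : q * (8 * M + 4) ≤ 2 ^ j)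
    {D Dp : Set Γ} {a : Γ}
    (hout : ∀ z ∈ D, κ ^ (wdist S a z + 1) ≤ GK μ D a z)
    (hin : ∀ x ∈ D, κ ^ (wdist S x a + 1) ≤ GK μ Dp x a)
    (i r : ℕ) (b : Γ) (hr : (2 * i + j + 2) * δ + 2 ≤ r) (E : Set Γ)
    (hE : ∀ y ∈ E, r ≤ wdist S y b) (x z : Γ) (hx : x ∈ D) (hz : z ∈ D) (hxz : x ∈ E ∨ z ∈ E)
    (hgp : gp S b x z ≤ 2 * δ) (hxa : wdist S x a ≤ 4 * (M * 2 ^ i))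
    (hza : wdist S z a ≤ 4 * (M * 2 ^ i)) :
    GK μ E x z ≤ 2⁻¹ ^ i * (GK μ Dp x a * GK μ D a z) := by
  have t := tail_bound hS hμ hδ hd b (2 * i + j) r hr E hE x z hxz hgp
  refine t.trans ?_
  have hi : i + 1 ≤ 2 ^ i := Nat.lt_two_pow_self
  have hN : q * (1 + i + ((wdist S x a + 1) + (wdist S a z + 1))) ≤ 2 ^ (2 * i + j) := by
    rw [wd_comm hS a z]
    have e1 : 1 + i + ((wdist S x a + 1) + (wdist S z a + 1)) ≤ (8 * M + 4) * 2 ^ i := by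
      nlinarith
    calc q * (1 + i + ((wdist S x a + 1) + (wdist S z a + 1))) ≤ q * ((8 * M + 4) * 2 ^ i) :=
          Nat.mul_le_mul_left _ e1
      _ = (q * (8 * M + 4)) * 2 ^ i := by ring
      _ ≤ 2 ^ j * 2 ^ i := Nat.mul_le_mul_right _ hj
      _ = 2 ^ (j + i) := by rw [pow_add]
      _ ≤ 2 ^ (2 * i + j) := Nat.pow_le_pow_right (by norm_num) (by omega)
  refine (err_bound hd h1 h2 h3 hN).trans ?_
  rw [pow_add κ]
  gcongr
  · exact hin x hx
  · exact hout z hz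

/-- left gates -/
def XG (S : Set Γ) (D : Set Γ) (γ : ℕ → Γ) (t0 s r : ℕ) (x : Γ) : Set Γ :=
  {y | y ∈ D ∧ ((s ≤ t0 ∧ wdist S y (γ (t0 - s)) ≤ r) ∨ (t0 < s ∧ y = x))}

/-- right gates -/
def ZG (S : Set Γ) (D : Set Γ) (γ : ℕ → Γ) (n t0 s r : ℕ) (z : Γ) : Set Γ :=
  {y | y ∈ D ∧ ((t0 + s ≤ n ∧ wdist S y (γ (t0 + s)) ≤ r) ∨ (n < t0 + s ∧ y = z))}

lemma XG_dist (hS : IsGenSet S) {D : Set Γ} {γ : ℕ → Γ} {n t0 s r c : ℕ} {x a : Γ}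
    (hγ : ∀ i j : ℕ, i ≤ j → j ≤ n → wdist S (γ i) (γ j) = j - i) (hx : γ 0 = x) (ht : t0 ≤ n)
    (ha : wdist S (γ t0) a ≤ c) {y : Γ} (hy : y ∈ XG S D γ t0 s r x) :
    wdist S y a ≤ s + r + c := by
  obtain ⟨-, ⟨h1, h2⟩ | ⟨h1, rfl⟩⟩ := hy
  · have e := hγ (t0 - s) t0 (by omega) ht
    have l1 := wd_tri hS y (γ (t0 - s)) a
    have l2 := wd_tri hS (γ (t0 - s)) (γ t0) a
    omega
  · have e := hγ 0 t0 (by omega) ht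
    have l2 := wd_tri hS (γ 0) (γ t0) a
    rw [hx] at e l2
    omega

lemma ZG_dist (hS : IsGenSet S) {D : Set Γ} {γ : ℕ → Γ} {n t0 s r c : ℕ} {z a : Γ}
    (hγ : ∀ i j : ℕ, i ≤ j → j ≤ n → wdist S (γ i) (γ j) = j - i) (hz : γ n = z) (ht : t0 ≤ n)
    (ha : wdist S (γ t0) a ≤ c) {y : Γ} (hy : y ∈ ZG S D γ n t0 s r z) :
    wdist S y a ≤ s + r + c := by
  obtain ⟨-, ⟨h1, h2⟩ | ⟨h1, rfl⟩⟩ := hy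
  · have e := hγ t0 (t0 + s) (by omega) h1
    rw [wd_comm hS] at e
    have l1 := wd_tri hS y (γ (t0 + s)) a
    have l2 := wd_tri hS (γ (t0 + s)) (γ t0) a
    omega
  · have e := hγ t0 n (by omega) le_rfl
    rw [wd_comm hS] at e
    have l2 := wd_tri hS (γ n) (γ t0) a
    rw [hz] at e l2
    omega

lemma XG_gate {D : Set Γ} {γ : ℕ → Γ} {δ t0 s r t : ℕ} {x : Γ}
    (hx : γ 0 = x) (htt : t0 ≤ t + s) (hr : r + 2 * δ + t0 < t + s) (hs : s ≤ t0 → t0 - s ≤ t)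
    {y : Γ} (hy : y ∈ XG S D γ t0 s r x) :
    ∃ s' ≤ t, (y = γ s' ∨ wdist S y (γ s') + 2 * δ < t - s') := by
  obtain ⟨-, ⟨h1, h2⟩ | ⟨h1, rfl⟩⟩ := hy
  · exact ⟨t0 - s, hs h1, Or.inr (by have := hs h1; omega)⟩
  · exact ⟨0, by omega, Or.inl hx.symm⟩

lemma ZG_gate {D : Set Γ} {γ : ℕ → Γ} {δ n t0 s r t : ℕ} {z : Γ}
    (hz : γ n = z) (ht : t ≤ n) (hr : r + 2 * δ + t < t0 + s)
    {y : Γ} (hy : y ∈ ZG S D γ n t0 s r z) :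
    ∃ s' ≤ n, t ≤ s' ∧ (y = γ s' ∨ wdist S y (γ s') + 2 * δ < s' - t) := by
  obtain ⟨-, ⟨h1, h2⟩ | ⟨h1, rfl⟩⟩ := hy
  · exact ⟨t0 + s, h1, by omega, Or.inr (by omega)⟩
  · exact ⟨n, le_rfl, ht, Or.inl hz.symm⟩

/-- Ancona type inequality -/
lemma ancona (hS : IsGenSet S) (hμ : IsRWMeasure S μ) {δ : ℕ} (hδ1 : 1 ≤ δ)
    (hδ : IsHyperbolic S (δ : ℝ)) {ρ C1 κ : ℝ≥0∞} (hd : Decay μ ρ C1) (hκ0 : 0 < κ)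
    (hκ1 : κ ≤ 1) (c : ℕ) : ∃ C : ℝ≥0∞, C ≠ ⊤ ∧ ∀ (D Dp : Set Γ) (a : Γ), D ⊆ Dp →
      (∀ z ∈ D, κ ^ (wdist S a z + 1) ≤ GK μ D a z) →
      (∀ x ∈ D, κ ^ (wdist S x a + 1) ≤ GK μ Dp x a) →
      ∀ (γ : ℕ → Γ) (n t0 : ℕ),
        (∀ i j : ℕ, i ≤ j → j ≤ n → wdist S (γ i) (γ j) = j - i) → t0 ≤ n →
        wdist S (γ t0) a ≤ c → ∀ x z, γ 0 = x → γ n = z → x ∈ D → z ∈ D →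
        GK μ D x z ≤ C * (GK μ Dp x a * GK μ D a z) := by
  obtain ⟨q, h1, h2, h3⟩ := exists_q hd hκ0
  obtain ⟨j, hj0⟩ := lin_le_two_pow (q * (16 * (δ + c))) (q * (128 * (δ + c) + 4))
  obtain ⟨M, hM⟩ : ∃ M, M = 2 * (j + 8) * (δ + c) := ⟨_, rfl⟩
  have hj : q * (8 * M + 4) ≤ 2 ^ j := by
    refine le_trans (le_of_eq ?_) hj0
    rw [hM]; ring
  have hM1 : 1 ≤ M := by
    rw [hM]; nlinarith
  obtain ⟨r, hr⟩ : ∃ r : ℕ → ℕ, ∀ i, r i = (2 * i + j + 2) * δ + 2 := ⟨_, fun _ => rfl⟩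
  obtain ⟨s, hs⟩ : ∃ s : ℕ → ℕ, ∀ i, s i = M * 2 ^ i := ⟨_, fun _ => rfl⟩
  have hss : ∀ i, s (i + 1) = 2 * s i := by intro i; rw [hs, hs, pow_succ]; ring
  have hrr : ∀ i, r i ≤ r (i + 1) := by
    intro i; rw [hr, hr]; gcongr; omega
  have hrs : ∀ i, r (i + 1) + 2 * δ + c < s i := by
    intro i
    rw [hr, hs, hM]
    have hi : i + 1 ≤ 2 ^ i := Nat.lt_two_pow_self
    have e1 : (2 * (i + 1) + j + 2) * δ + 2 + 2 * δ + c ≤ (2 * i + j + 8) * (δ + c) := by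
      nlinarith [Nat.zero_le (i * c), Nat.zero_le (j * c)]
    have e2 : 2 * i + j + 8 < 2 * (j + 8) * 2 ^ i := by nlinarith [Nat.zero_le (j * i)]
    calc _ ≤ (2 * i + j + 8) * (δ + c) := e1
      _ < (2 * (j + 8) * 2 ^ i) * (δ + c) := Nat.mul_lt_mul_of_pos_right e2 (by omega)
      _ = _ := by ring
  obtain ⟨C0, hC0⟩ : ∃ C0, C0 = C1 / κ ^ (6 * M + 2) := ⟨_, rfl⟩
  have hκt : κ ≠ ⊤ := (hκ1.trans_lt ENNReal.one_lt_top).ne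
  have hC0t : C0 ≠ ⊤ := by
    rw [hC0]; exact ENNReal.div_ne_top hd.ctop (pow_ne_zero _ hκ0.ne')
  refine ⟨C0 + 4, by simp [hC0t], ?_⟩
  intro D Dp a hDD hout hin γ n t0 hγ ht0 hta x z hx0 hzn hxD hzD
  obtain ⟨f, hf⟩ : ∃ f : ℕ → ℝ≥0∞, ∀ i, f i = C0 + 2 * ∑ l ∈ Finset.range i, 2⁻¹ ^ l :=
    ⟨_, fun _ => rfl⟩
  have hfs : ∀ i, f (i + 1) = f i + 2⁻¹ ^ i + 2⁻¹ ^ i := by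
    intro i; rw [hf, hf, Finset.sum_range_succ]; ring
  have dX : ∀ i, ∀ y ∈ XG S D γ t0 (s i) (r i) x, wdist S y a ≤ s i + r i + c :=
    fun i y hy => XG_dist hS hγ hx0 ht0 hta hy
  have dZ : ∀ i, ∀ y ∈ ZG S D γ n t0 (s i) (r i) z, wdist S y a ≤ s i + r i + c :=
    fun i y hy => ZG_dist hS hγ hzn ht0 hta hy
  have main : ∀ i, ∀ x' ∈ XG S D γ t0 (s i) (r i) x, ∀ z' ∈ ZG S D γ n t0 (s i) (r i) z,
      GK μ D x' z' ≤ f i * (GK μ Dp x' a * GK μ D a z') := by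
    intro i
    induction i with
    | zero =>
      intro x' hx' z' hz'
      have e1 := dX 0 x' hx'
      have e2 := dZ 0 z' hz'
      have e3 := hrs 0
      have e4 := hrr 0
      have e5 : s 0 = M := by rw [hs]; simp
      have e0 : f 0 = C0 := by rw [hf]; simp
      rw [e0]
      have hp : κ ^ (6 * M + 2) ≤ GK μ Dp x' a * GK μ D a z' := by
        calc κ ^ (6 * M + 2) ≤ κ ^ ((wdist S x' a + 1) + (wdist S a z' + 1)) := by
              apply pow_le_pow_right_of_le_one' hκ1
              rw [wd_comm hS a z']; omega
          _ = κ ^ (wdist S x' a + 1) * κ ^ (wdist S a z' + 1) := pow_add _ _ _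
          _ ≤ _ := by
            gcongr
            · exact hin x' hx'.1
            · exact hout z' hz'.1
      calc GK μ D x' z' ≤ C1 := hd.bound _ _ _
        _ = C0 * κ ^ (6 * M + 2) := by
          rw [hC0, ENNReal.div_mul_cancel (pow_ne_zero _ hκ0.ne') (ENNReal.pow_ne_top hκt)]
        _ ≤ _ := by gcongr
    | succ i ih =>
      have e3 := hrs i
      have e4 := hrr i
      have e5 := hss i
      have e6 := hs i
      -- step A
      have stepA : ∀ x' ∈ XG S D γ t0 (s i) (r i) x,
          ∀ z' ∈ ZG S D γ n t0 (s (i + 1)) (r (i + 1)) z,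
          GK μ D x' z' ≤ (f i + 2⁻¹ ^ i) * (GK μ Dp x' a * GK μ D a z') := by
        intro x' hx' z' hz'
        by_cases hact : t0 + s i ≤ n
        · obtain ⟨E, hEdef⟩ : ∃ E : Set Γ, E = {y | y ∈ D ∧ r i < wdist S y (γ (t0 + s i))} :=
            ⟨_, rfl⟩
          have hED : E ⊆ D := by rw [hEdef]; exact fun y hy => hy.1
          have hb : ∀ w ∈ D, w ∉ E → GK μ D x' w ≤ f i * (GK μ Dp x' a * GK μ D a w) := by
            intro w hw hwE
            refine ih x' hx' w ⟨hw, Or.inl ⟨hact, ?_⟩⟩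
            rw [hEdef] at hwE
            by_contra hc
            exact hwE ⟨hw, not_le.1 hc⟩
          by_cases hzE : z' ∈ E
          · have l := lemM' (μ := μ) hED x' (fun w => f i * (GK μ Dp x' a * GK μ D a w)) (by
              intro w _
              calc ∑' y, f i * (GK μ Dp x' a * GK μ D a y) * QK μ D y w
                  = f i * (GK μ Dp x' a * ∑' y, GK μ D a y * QK μ D y w) := by
                    simp only [mul_assoc]
                    rw [ENNReal.tsum_mul_left, ENNReal.tsum_mul_left]
                _ ≤ _ := by gcongr; exact GK_super_right D a w) hb z' hz'.1
            obtain ⟨sx, a1, a2⟩ := XG_gate (S := S) (D := D) (δ := δ) (t := t0 + s i) hx0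
              (by omega) (by omega) (by omega) hx'
            obtain ⟨sz, b1, b2, b3⟩ := ZG_gate (S := S) (D := D) (δ := δ) (t := t0 + s i) hzn
              hact (by omega) hz'
            have hg := gate_gp hS hδ hγ a1 b2 b1 a2 b3
            have d1 := dX i x' hx'
            have d2 := dZ (i + 1) z' hz'
            have er := step_err hS hμ hδ hd hκ1 h1 h2 h3 hj hout hin i (r i) (γ (t0 + s i))
              (hr i).ge E (by rw [hEdef]; exact fun y hy => hy.2.le) x' z' hx'.1 hz'.1
              (Or.inr hzE) hg (by omega) (by omega)
            calc GK μ D x' z' ≤ _ := l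
              _ ≤ f i * (GK μ Dp x' a * GK μ D a z') + 2⁻¹ ^ i * (GK μ Dp x' a * GK μ D a z') :=
                add_le_add le_rfl er
              _ = _ := by rw [add_mul]
          · refine (hb z' hz'.1 hzE).trans ?_
            gcongr
            exact le_self_add
        · have hz2 : z' ∈ ZG S D γ n t0 (s i) (r i) z := by
            obtain ⟨hD, ⟨g1, g2⟩ | ⟨g1, g2⟩⟩ := hz'
            · omega
            · exact ⟨hD, Or.inr ⟨by omega, g2⟩⟩
          refine (ih x' hx' z' hz2).trans ?_
          gcongr
          exact le_self_add
      intro x' hx' z' hz'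
      rw [hfs]
      by_cases hact : s i ≤ t0
      · obtain ⟨E, hEdef⟩ : ∃ E : Set Γ, E = {y | y ∈ D ∧ r i < wdist S y (γ (t0 - s i))} :=
          ⟨_, rfl⟩
        have hED : E ⊆ D := by rw [hEdef]; exact fun y hy => hy.1
        have hb : ∀ w ∈ D, w ∉ E →
            GK μ D w z' ≤ (f i + 2⁻¹ ^ i) * (GK μ Dp w a * GK μ D a z') := by
          intro w hw hwE
          refine stepA w ⟨hw, Or.inl ⟨hact, ?_⟩⟩ z' hz'
          rw [hEdef] at hwE
          by_contra hc
          exact hwE ⟨hw, not_le.1 hc⟩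
        by_cases hxE : x' ∈ E
        · have l := lemM (μ := μ) hED z'
            (fun w => (f i + 2⁻¹ ^ i) * (GK μ Dp w a * GK μ D a z')) (by
            intro w _
            calc ∑' y, QK μ D w y * ((f i + 2⁻¹ ^ i) * (GK μ Dp y a * GK μ D a z'))
                = (f i + 2⁻¹ ^ i) * ((∑' y, QK μ D w y * GK μ Dp y a) * GK μ D a z') := by
                  rw [← ENNReal.tsum_mul_right, ← ENNReal.tsum_mul_left]
                  refine tsum_congr (fun y => ?_)
                  ring
              _ ≤ _ := by gcongr; exact GK_super D Dp hDD w a) hb x' hx'.1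
          obtain ⟨sx, a1, a2⟩ := XG_gate (S := S) (D := D) (δ := δ) (t := t0 - s i) hx0
            (by omega) (by omega) (by omega) hx'
          obtain ⟨sz, b1, b2, b3⟩ := ZG_gate (S := S) (D := D) (δ := δ) (t := t0 - s i) hzn
            (by omega) (by omega) hz'
          have hg := gate_gp hS hδ hγ a1 b2 b1 a2 b3
          have d1 := dX (i + 1) x' hx'
          have d2 := dZ (i + 1) z' hz'
          have er := step_err hS hμ hδ hd hκ1 h1 h2 h3 hj hout hin i (r i) (γ (t0 - s i))
            (hr i).ge E (by rw [hEdef]; exact fun y hy => hy.2.le) x' z' hx'.1 hz'.1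
            (Or.inl hxE) hg (by omega) (by omega)
          calc GK μ D x' z' ≤ _ := l
            _ ≤ (f i + 2⁻¹ ^ i) * (GK μ Dp x' a * GK μ D a z')
                + 2⁻¹ ^ i * (GK μ Dp x' a * GK μ D a z') := add_le_add le_rfl er
            _ = _ := by rw [← add_mul]
        · refine (hb x' hx'.1 hxE).trans ?_
          gcongr
          exact le_self_add
      · have hx2 : x' ∈ XG S D γ t0 (s i) (r i) x := by
          obtain ⟨hD, ⟨g1, g2⟩ | ⟨g1, g2⟩⟩ := hx'
          · omega
          · exact ⟨hD, Or.inr ⟨by omega, g2⟩⟩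
        refine (stepA x' hx2 z' hz').trans ?_
        gcongr
        exact le_self_add
  have hbig : n < s n := by
    rw [hs]
    have : n < 2 ^ n := Nat.lt_two_pow_self
    nlinarith
  have hfin := main n x ⟨hxD, Or.inr ⟨by omega, rfl⟩⟩ z ⟨hzD, Or.inr ⟨by omega, rfl⟩⟩
  refine hfin.trans ?_
  gcongr
  rw [hf]
  gcongr
  calc 2 * ∑ l ∈ Finset.range n, (2⁻¹ : ℝ≥0∞) ^ l ≤ 2 * ∑' l, (2⁻¹ : ℝ≥0∞) ^ l := by
        gcongr; exact ENNReal.sum_le_tsum _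
    _ = 4 := by
      rw [ENNReal.tsum_geometric, ENNReal.one_sub_inv_two, inv_inv]; norm_num

end AnconaPart
section PathPart

variable {S : Set Γ} {μ : Γ → ℝ}

/-- `w` is obtained from `y` by a prefix of one of the chosen words -/
def NearW (S : Set Γ) (W : Γ → List Γ) (y w : Γ) : Prop :=
  w = y ∨ ∃ s ∈ S, ∃ i : ℕ, w = y * ((W s).take i).prod

lemma words_exist (hS : IsGenSet S) (hμ : IsRWMeasure S μ) :
    ∃ (W : Γ → List Γ) (L : ℕ), (∀ g, ∀ t ∈ W g, 0 < μ t) ∧ (∀ g, (W g).prod = g) ∧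
      ∀ s ∈ S, (W s).length ≤ L := by
  choose W _ h2 h3 using hμ.nondeg
  obtain ⟨L, hL⟩ := (hS.1.image fun s => (W s).length).bddAbove
  exact ⟨W, L, h2, h3, fun s hs => hL ⟨s, hs, rfl⟩⟩

lemma nearW_dist (hμ : IsRWMeasure S μ) {W : Γ → List Γ} {L : ℕ}
    (h1 : ∀ g, ∀ t ∈ W g, 0 < μ t) (h3 : ∀ s ∈ S, (W s).length ≤ L) {y w : Γ}
    (h : NearW S W y w) : wdist S y w ≤ L := by
  rcases h with rfl | ⟨s, hs, i, rfl⟩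
  · rw [wd_self]; omega
  · have := wl_le_of_word (S := S) ((W s).take i) (fun t ht =>
      hμ.support_subset t (ne_of_gt (h1 s t (List.mem_of_mem_take ht))))
    have h4 := h3 s hs
    have h5 : ((W s).take i).length ≤ (W s).length := by rw [List.length_take]; omega
    unfold wdist
    rw [inv_mul_cancel_left]
    omega

lemma geo_path {W : Γ → List Γ} {L : ℕ}
    (h1 : ∀ g, ∀ t ∈ W g, 0 < μ t) (h2 : ∀ g, (W g).prod = g) (h3 : ∀ s ∈ S, (W s).length ≤ L)
    (x : Γ) (γ : ℕ → Γ) (h0 : γ 0 = x) (n : ℕ) (hγ : ∀ i < n, (γ i)⁻¹ * γ (i + 1) ∈ S) :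
    ∃ l : List Γ, (∀ t ∈ l, 0 < μ t) ∧ x * l.prod = γ n ∧ l.length ≤ L * n ∧
      ∀ i, ∃ j ≤ n, NearW S W (γ j) (x * (l.take i).prod) := by
  induction n with
  | zero => exact ⟨[], by simp, by simp [h0], by simp, fun i => ⟨0, le_rfl, Or.inl (by simp [h0])⟩⟩
  | succ n ih =>
    obtain ⟨l, a1, a2, a3, a4⟩ := ih (fun i hi => hγ i (by omega))
    have hs := hγ n (by omega)
    refine ⟨l ++ W ((γ n)⁻¹ * γ (n + 1)), ?_, ?_, ?_, ?_⟩
    · intro t ht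
      rcases List.mem_append.1 ht with h | h
      · exact a1 t h
      · exact h1 _ t h
    · rw [List.prod_append, ← mul_assoc, a2, h2, mul_inv_cancel_left]
    · rw [List.length_append]
      have := h3 _ hs
      rw [mul_add, mul_one]
      omega
    · intro i
      rw [List.take_append, List.prod_append, ← mul_assoc]
      by_cases hi : i ≤ l.length
      · obtain ⟨j, hj, h⟩ := a4 i
        refine ⟨j, by omega, ?_⟩
        have : i - l.length = 0 := by omega
        rw [this]
        simpa using h
      · refine ⟨n, by omega, Or.inr ⟨_, hs, i - l.length, ?_⟩⟩
        rw [List.take_of_length_le (by omega), a2]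

lemma unit_mem (hS : IsGenSet S) {x y : Γ} (h : wdist S x y = 1) : x⁻¹ * y ∈ S := by
  obtain ⟨w, hw, hw', hp⟩ := wl_exists hS (x⁻¹ * y)
  have : w.length = 1 := by rw [hw]; exact h
  obtain ⟨s, rfl⟩ := List.length_eq_one_iff.1 this
  rw [← hp]
  simpa using hw'

lemma kpow_le_GK (D : Set Γ) (n : ℕ) (x z : Γ) : kpow (QK μ D) n x z ≤ GK μ D x z :=
  ENNReal.le_tsum n

/-- a point on a geodesic between x and z -/
lemma lev_between (hS : IsGenSet S) {δ : ℕ} (hδ : IsHyperbolic S (δ : ℝ)) (p q x y z : Γ) (l : ℝ)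
    (h : wdist S x y + wdist S y z = wdist S x z) (hx : l < gp S p x q) (hz : l < gp S p z q) :
    l - 2 * δ < gp S p y q := by
  have hδ0 : (0 : ℝ) ≤ δ := by positivity
  have e : gp S p x z ≤ gp S p y x := by
    rw [gp_comm hS p y x]
    unfold gp
    have t := wd_tri hS z y p
    rw [wd_comm hS z y] at t
    have t' : (wdist S z p : ℝ) ≤ wdist S y z + wdist S y p := by exact_mod_cast t
    have h' : (wdist S x y : ℝ) + wdist S y z = wdist S x z := by exact_mod_cast h
    linarith
  have e2 : l - δ < gp S p x z := by
    rcases hyp4 hδ hS p x z q with h | h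
    · linarith
    · rw [gp_comm hS p q z] at h; linarith
  rcases hyp4 hδ hS p y q x with h | h
  · linarith
  · linarith

/-- a geodesic passes close to a point with small Gromov product -/
lemma near_point (hS : IsGenSet S) {δ : ℕ} (hδ : IsHyperbolic S (δ : ℝ)) (a x z : Γ)
    (h : gp S a x z ≤ 2 * δ) {γ : ℕ → Γ} {n : ℕ} (h0 : γ 0 = x) (hn : γ n = z)
    (hnd : n = wdist S x z)
    (hγ : ∀ i j : ℕ, i ≤ j → j ≤ n → wdist S (γ i) (γ j) = j - i) :
    ∃ t ≤ n, wdist S (γ t) a ≤ 6 * δ + 1 := by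
  classical
  have hδ0 : (0 : ℝ) ≤ δ := by positivity
  have hex : ∃ t, gp S a x (γ t) ≤ 3 * δ := ⟨n, by rw [hn]; linarith⟩
  set t := Nat.find hex with ht
  have ht1 : gp S a x (γ t) ≤ 3 * δ := Nat.find_spec hex
  have htn : t ≤ n := Nat.find_min' hex (by rw [hn]; linarith)
  refine ⟨t, htn, ?_⟩
  rcases Nat.eq_zero_or_pos t with h00 | hpos
  · rw [h00, h0, gp_self] at ht1
    rw [h00, h0]
    have : wdist S x a ≤ 3 * δ := by exact_mod_cast ht1
    omega
  · have hm := Nat.find_min hex (m := t - 1) (by omega)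
    push Not at hm
    have h3 : gp S a z (γ (t - 1)) ≤ 3 * δ := by
      rcases hyp4 hδ hS a x z (γ (t - 1)) with h' | h'
      · linarith
      · rw [gp_comm hS]; linarith
    have hstep := hγ (t - 1) t (by omega) htn
    have h4 := gp_lip hS a (γ t) (γ (t - 1)) z
    rw [wd_comm hS, hstep, gp_comm hS a (γ (t - 1)) z] at h4
    have : ((t - (t - 1) : ℕ) : ℝ) = 1 := by
      have : t - (t - 1) = 1 := by omega
      rw [this]; simp
    rw [this] at h4
    have d1 : wdist S x (γ t) = t := by
      have := hγ 0 t (by omega) htn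
      rwa [h0, Nat.sub_zero] at this
    have d2 : wdist S (γ t) z = n - t := by
      have := hγ t n htn le_rfl
      rwa [hn] at this
    have hsum : (wdist S (γ t) a : ℝ) ≤ gp S a x (γ t) + gp S a (γ t) z := by
      have hg := gp_nonneg hS a x z
      have d3 : (wdist S x (γ t) : ℝ) + wdist S (γ t) z = wdist S x z := by
        have : wdist S x (γ t) + wdist S (γ t) z = wdist S x z := by omega
        exact_mod_cast this
      unfold gp at hg ⊢
      linarith
    have : (wdist S (γ t) a : ℝ) ≤ ((6 * δ + 1 : ℕ) : ℝ) := by push_cast; linarith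
    exact_mod_cast this

lemma gp_change (b a x z : Γ) (hS : IsGenSet S) :
    gp S a x z = wdist S a b - gp S b x a - gp S b z a + gp S b x z := by
  unfold gp; ring

/-- the star shaped set of points on geodesics from `a` to level `l` -/
def YS (S : Set Γ) (p a : Γ) (l : ℝ) : Set Γ :=
  {y | ∃ z ∈ Cset S p l, wdist S a y + wdist S y z = wdist S a z}

/-- its thickening -/
def DS (S : Set Γ) (W : Γ → List Γ) (p a : Γ) (l : ℝ) : Set Γ :=
  {w | ∃ y ∈ YS S p a l, NearW S W y w}

lemma path_GK {κ : ℝ≥0∞} (hκ1 : κ ≤ 1) (hκ : ∀ x s : Γ, 0 < μ s → κ ≤ PK μ x (x * s)) (D : Set Γ)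
    (l : List Γ) (hl : ∀ s ∈ l, 0 < μ s) (x z : Γ) (hz : x * l.prod = z)
    (hD : ∀ i, x * (l.take i).prod ∈ D) {N : ℕ} (hN : l.length ≤ N) :
    κ ^ N ≤ GK μ D x z := by
  subst hz
  exact (pow_le_pow_right_of_le_one' hκ1 hN).trans
    ((path_lower hκ D l hl x (fun i _ => hD i)).trans (kpow_le_GK _ _ _ _))

lemma DS_out (hS : IsGenSet S) (hμ : IsRWMeasure S μ) {W : Γ → List Γ} {L : ℕ}
    (h1 : ∀ g, ∀ t ∈ W g, 0 < μ t) (h2 : ∀ g, (W g).prod = g) (h3 : ∀ s ∈ S, (W s).length ≤ L)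
    {κ : ℝ≥0∞} (hκ1 : κ ≤ 1) (hκ : ∀ x s : Γ, 0 < μ s → κ ≤ PK μ x (x * s)) (p a : Γ) (l : ℝ)
    (z : Γ) (hz : z ∈ DS S W p a l) :
    (κ ^ (L * L + L)) ^ (wdist S a z + 1) ≤ GK μ (DS S W p a l) a z := by
  obtain ⟨y, ⟨z0, hz0, hy⟩, hw⟩ := hz
  obtain ⟨γ, g0, gn, hγ⟩ := geod_exists hS a y
  have hyz := nearW_dist hμ h1 h3 hw
  obtain ⟨w, b1, b2, b3, b4⟩ := geo_path h1 h2 h3 a γ g0 (wdist S a y) (fun i hi => by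
    apply unit_mem hS
    rw [hγ i (i + 1) (by omega) (by omega)]
    omega)
  have hY : ∀ j ≤ wdist S a y, γ j ∈ YS S p a l := by
    intro j hj
    refine ⟨z0, hz0, ?_⟩
    have c1 := hγ 0 j (by omega) hj
    have c2 := hγ j _ hj le_rfl
    rw [g0] at c1
    rw [gn] at c2
    have c3 := wd_tri hS (γ j) y z0
    have c4 := wd_tri hS a (γ j) z0
    omega
  have hb4 : ∀ i, a * (w.take i).prod ∈ DS S W p a l := by
    intro i
    obtain ⟨j, hj, h⟩ := b4 i
    exact ⟨γ j, hY j hj, h⟩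
  rw [gn] at b2
  have hay : wdist S a y ≤ wdist S a z + L := by
    have := wd_tri hS a z y
    rw [wd_comm hS z y] at this
    omega
  have hnum : L * wdist S a y + L ≤ (L * L + L) * (wdist S a z + 1) := by
    nlinarith [Nat.mul_le_mul_left L hay, Nat.zero_le (L * L * wdist S a z)]
  rw [← pow_mul]
  rcases hw with rfl | ⟨s, hs, i, rfl⟩
  · exact path_GK hκ1 hκ _ w b1 a z b2 hb4 (by omega)
  · refine path_GK hκ1 hκ _ (w ++ (W s).take i) ?_ a _ ?_ ?_ ?_
    · intro t ht
      rcases List.mem_append.1 ht with h | h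
      · exact b1 t h
      · exact h1 _ t (List.mem_of_mem_take h)
    · rw [List.prod_append, ← mul_assoc, b2]
    · intro i'
      rw [List.take_append, List.prod_append, ← mul_assoc]
      by_cases hi : i' ≤ w.length
      · have : i' - w.length = 0 := by omega
        rw [this]
        simpa using hb4 i'
      · rw [List.take_of_length_le (by omega), b2, List.take_take]
        exact ⟨y, ⟨z0, hz0, hy⟩, Or.inr ⟨s, hs, _, rfl⟩⟩
    · have h4 := h3 s hs
      have h5 : ((W s).take i).length ≤ (W s).length := by rw [List.length_take]; omega
      rw [List.length_append]
      omega

lemma YS_lev (hS : IsGenSet S) {δ : ℕ} (hδ : IsHyperbolic S (δ : ℝ)) {p a : Γ} {l : ℝ}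
    (ha : a ∈ Cset S p l) {y : Γ} (hy : y ∈ YS S p a l) : y ∈ Cset S p (l - 2 * δ) := by
  obtain ⟨z, hz, h⟩ := hy
  exact lev_between hS hδ p 1 a y z l h ha hz

lemma near_lev (hS : IsGenSet S) {p y w : Γ} {l : ℝ} {L : ℕ} (hy : y ∈ Cset S p l)
    (h : wdist S y w ≤ L) : w ∈ Cset S p (l - L) := by
  have := gp_lip hS p y w 1
  have h' : (wdist S y w : ℝ) ≤ L := by exact_mod_cast h
  have hy' : l < gp S p y 1 := hy
  change l - L < gp S p w 1
  linarith

lemma DS_lev (hS : IsGenSet S) (hμ : IsRWMeasure S μ) {δ : ℕ} (hδ : IsHyperbolic S (δ : ℝ))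
    {W : Γ → List Γ} {L : ℕ}
    (h1 : ∀ g, ∀ t ∈ W g, 0 < μ t) (h3 : ∀ s ∈ S, (W s).length ≤ L) {p a : Γ} {l : ℝ}
    (ha : a ∈ Cset S p l) {y : Γ} (hy : y ∈ DS S W p a l) : y ∈ Cset S p (l - 2 * δ - L) := by
  obtain ⟨y', hy', h⟩ := hy
  exact near_lev hS (YS_lev hS hδ ha hy') (nearW_dist hμ h1 h3 h)

lemma DS_in (hS : IsGenSet S) (hμ : IsRWMeasure S μ) {δ : ℕ} (hδ : IsHyperbolic S (δ : ℝ))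
    {W : Γ → List Γ} {L : ℕ}
    (h1 : ∀ g, ∀ t ∈ W g, 0 < μ t) (h2 : ∀ g, (W g).prod = g) (h3 : ∀ s ∈ S, (W s).length ≤ L)
    {κ : ℝ≥0∞} (hκ1 : κ ≤ 1) (hκ : ∀ x s : Γ, 0 < μ s → κ ≤ PK μ x (x * s)) (p a : Γ) (l : ℝ)
    (ha : a ∈ Cset S p l) (x : Γ) (hx : x ∈ DS S W p a l) :
    (κ ^ (L * L + L)) ^ (wdist S x a + 1) ≤ GK μ (Cset S p (l - 4 * δ - 2 * L)) x a := by
  have hx' := DS_lev hS hμ hδ h1 h3 ha hx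
  have hδ0 : (0 : ℝ) ≤ δ := by positivity
  have hL0 : (0 : ℝ) ≤ L := by positivity
  have ha' : a ∈ Cset S p (l - 2 * δ - L) := by
    have : l < gp S p a 1 := ha
    change l - 2 * δ - L < gp S p a 1
    linarith
  obtain ⟨γ, g0, gn, hγ⟩ := geod_exists hS x a
  obtain ⟨w, b1, b2, b3, b4⟩ := geo_path h1 h2 h3 x γ g0 (wdist S x a) (fun i hi => by
    apply unit_mem hS
    rw [hγ i (i + 1) (by omega) (by omega)]
    omega)
  rw [gn] at b2
  rw [← pow_mul]
  refine path_GK hκ1 hκ _ w b1 x a b2 ?_ ?_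
  · intro i
    obtain ⟨j, hj, h⟩ := b4 i
    have c1 := hγ 0 j (by omega) hj
    have c2 := hγ j _ hj le_rfl
    rw [g0] at c1
    rw [gn] at c2
    have hl := lev_between hS hδ p 1 x (γ j) a _ (by omega) hx' ha'
    have := near_lev hS (l := l - 2 * δ - L - 2 * δ) hl (nearW_dist hμ h1 h3 h)
    convert this using 2
    ring
  · nlinarith [Nat.zero_le (L * L * wdist S x a)]

lemma Cset_sub_DS {W : Γ → List Γ} {p a : Γ} {l : ℝ} : Cset S p l ⊆ DS S W p a l := by
  intro x hx
  exact ⟨x, ⟨x, hx, by rw [wd_self]; simp⟩, Or.inl rfl⟩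

end PathPart
section FinalPart

variable {S : Set Γ} {μ : Γ → ℝ}

lemma harm_PK (hS : IsGenSet S) (hμ : IsRWMeasure S μ) {u : Γ → ℝ} {Λ : Set Γ}
    (hpos : ∀ g ∈ Λ, 0 < u g) (hh : HarmonicOn μ u Λ) {x : Γ}
    (hx : ∀ y, wdist S x y ≤ 1 → y ∈ Λ) :
    ∑' h, PK μ x h * ENNReal.ofReal (u h) = ENNReal.ofReal (u x) := by
  have hxx := hh x (hx x (by rw [wd_self]; omega))
  have hmem : ∀ h, μ (x⁻¹ * h) ≠ 0 → h ∈ Λ := by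
    intro h hne
    exact hx h (wl_gen (hμ.support_subset _ hne))
  have hnn : ∀ h, 0 ≤ μ (x⁻¹ * h) * u h := by
    intro h
    by_cases h0 : μ (x⁻¹ * h) = 0
    · rw [h0, zero_mul]
    · exact mul_nonneg (hμ.nonneg _) (hpos h (hmem h h0)).le
  have hsum : Summable fun h => μ (x⁻¹ * h) * u h := by
    apply summable_of_hasFiniteSupport
    refine (hS.1.image fun s => x * s).subset ?_
    intro h hne
    have : μ (x⁻¹ * h) ≠ 0 := left_ne_zero_of_mul hne
    exact ⟨x⁻¹ * h, hμ.support_subset _ this, by simp⟩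
  have e : ∑' h, ENNReal.ofReal (μ (x⁻¹ * h)) * ENNReal.ofReal (u h) = ENNReal.ofReal (u x) := by
    rw [← hxx, ENNReal.ofReal_tsum_of_nonneg hnn hsum]
    exact tsum_congr fun h => (ENNReal.ofReal_mul (hμ.nonneg _)).symm
  unfold PK
  simp only [add_mul, mul_assoc]
  rw [ENNReal.tsum_add, ENNReal.tsum_mul_left, ENNReal.tsum_mul_left, tsum_kone_left, e, ← add_mul,
    ENNReal.inv_two_add_inv_two, one_mul]

open Classical in
/-- boundary flux -/
noncomputable def flux (μ : Γ → ℝ) (D : Set Γ) (U : Γ → ℝ≥0∞) (x : Γ) : ℝ≥0∞ :=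
  ∑' h, (if h ∈ D then 0 else PK μ x h) * U h

lemma flux_split {D : Set Γ} {U : Γ → ℝ≥0∞} {x : Γ} (hx : x ∈ D)
    (h : ∑' y, PK μ x y * U y = U x) : U x = flux μ D U x + ∑' y, QK μ D x y * U y := by
  classical
  unfold flux
  rw [← ENNReal.tsum_add, ← h]
  refine tsum_congr fun y => ?_
  by_cases hy : y ∈ D
  · rw [QK_of_mem hx hy]; simp [hy]
  · simp [hy, QK]

lemma repr_step {D : Set Γ} {U : Γ → ℝ≥0∞} (h : ∀ x ∈ D, ∑' y, PK μ x y * U y = U x) (N : ℕ)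
    {x : Γ} (hx : x ∈ D) :
    U x = ∑ n ∈ Finset.range N, ∑' z, kpow (QK μ D) n x z * flux μ D U z
      + ∑' z, kpow (QK μ D) N x z * U z := by
  induction N with
  | zero => simp only [Finset.range_zero, Finset.sum_empty, zero_add, kpow_zero]; rw [tsum_kone_left]
  | succ N ih =>
    rw [Finset.sum_range_succ, add_assoc]
    refine ih.trans ?_
    congr 1
    have e : ∑' z, kpow (QK μ D) (N + 1) x z * U z
        = ∑' z, kpow (QK μ D) N x z * ∑' y, QK μ D z y * U y := by
      rw [ker_assoc]
      simp only [kpow_succ']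
    rw [e, ← ENNReal.tsum_add]
    refine tsum_congr fun z => ?_
    by_cases hz : kpow (QK μ D) N x z = 0
    · simp [hz]
    · have hzD := (kpow_QK_mem hz).1 hx
      rw [← mul_add, ← flux_split hzD (h z hzD)]

lemma repr_ge {D : Set Γ} {U : Γ → ℝ≥0∞} (h : ∀ x ∈ D, ∑' y, PK μ x y * U y = U x)
    {x : Γ} (hx : x ∈ D) : ∑' z, GK μ D x z * flux μ D U z ≤ U x := by
  unfold GK
  simp only [← ENNReal.tsum_mul_right]
  rw [ENNReal.tsum_comm]
  refine ENNReal.tsum_le_of_sum_range_le fun N => ?_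
  conv_rhs => rw [repr_step h N hx]
  exact le_self_add

lemma repr_le (hS : IsGenSet S) (hμ : IsRWMeasure S μ) {ρ C : ℝ≥0∞} (hd : Decay μ ρ C)
    {D : Set Γ} {U : Γ → ℝ≥0∞} (hU : ∀ x, U x ≠ ⊤) (h : ∀ x ∈ D, ∑' y, PK μ x y * U y = U x)
    (hv : ∀ ε : ℝ≥0∞, 0 < ε → ε ≠ ⊤ → ∃ M : ℕ, ∀ g ∈ D, M ≤ wl S g → U g ≤ ε)
    {x : Γ} (hx : x ∈ D) : U x ≤ ∑' z, GK μ D x z * flux μ D U z := by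
  classical
  refine ENNReal.le_of_forall_pos_le_add fun ε hε _ => ?_
  obtain ⟨M, hM⟩ := hv ε (by simpa using hε) (by simp)
  obtain ⟨F, hF⟩ : ∃ F : Finset Γ, ∀ g, g ∈ F ↔ wl S g ≤ M :=
    ⟨(ball_finite hS M).toFinset, fun g => by simp⟩
  have key : ∀ N : ℕ, U x ≤ (∑' z, GK μ D x z * flux μ D U z + ε) + (C * ∑ g ∈ F, U g) * ρ ^ N := by
    intro N
    rw [repr_step h N hx, add_assoc]
    have e1 : ∑ n ∈ Finset.range N, ∑' z, kpow (QK μ D) n x z * flux μ D U z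
        ≤ ∑' z, GK μ D x z * flux μ D U z := by
      unfold GK
      simp only [← ENNReal.tsum_mul_right]
      rw [ENNReal.tsum_comm]
      exact ENNReal.sum_le_tsum _
    refine add_le_add e1 ?_
    calc ∑' z, kpow (QK μ D) N x z * U z
        ≤ ∑' z, (kpow (PK μ) N x z * ε + (if z ∈ F then C * ρ ^ N * U z else 0)) := by
          refine ENNReal.tsum_le_tsum fun z => ?_
          by_cases hz : kpow (QK μ D) N x z = 0
          · simp [hz]
          · have hzD := (kpow_QK_mem hz).1 hx
            by_cases hzF : z ∈ F
            · rw [if_pos hzF]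
              refine le_trans ?_ le_add_self
              gcongr
              exact (kpow_mono (QK_le D) N x z).trans (hd.single N x z)
            · rw [if_neg hzF, add_zero]
              gcongr
              · exact kpow_mono (QK_le D) N x z
              · rw [hF] at hzF
                exact hM z hzD (by omega)
      _ = ε + C * ρ ^ N * ∑ g ∈ F, U g := by
          rw [ENNReal.tsum_add, ENNReal.tsum_mul_right, kpow_row (PK_row hμ), one_mul,
            tsum_eq_sum (s := F) (fun b hb => by simp [hb]), Finset.mul_sum]
          congr 1
          exact Finset.sum_congr rfl fun g hg => by simp [hg]
      _ = ε + (C * ∑ g ∈ F, U g) * ρ ^ N := by ring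
  have hfin : C * ∑ g ∈ F, U g ≠ ⊤ :=
    ENNReal.mul_ne_top hd.ctop (by simp [ENNReal.sum_eq_top, hU])
  have ht : Tendsto (fun N : ℕ => (∑' z, GK μ D x z * flux μ D U z + ε)
      + (C * ∑ g ∈ F, U g) * ρ ^ N) atTop
      (𝓝 ((∑' z, GK μ D x z * flux μ D U z + ε) + (C * ∑ g ∈ F, U g) * 0)) := by
    refine Tendsto.add tendsto_const_nhds ?_
    exact ENNReal.Tendsto.const_mul (ENNReal.tendsto_pow_atTop_nhds_zero_of_lt_one hd.rlt)
      (Or.inr hfin)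
  have := ge_of_tendsto' ht key
  simpa using this

lemma GK_le_harm {ρ C : ℝ≥0∞} (hd : Decay μ ρ C) {D : Set Γ} {V : Γ → ℝ≥0∞}
    (h : ∀ x ∈ D, ∑' y, PK μ x y * V y = V x) {a : Γ} (ha0 : V a ≠ 0) (hat : V a ≠ ⊤)
    {x : Γ} (hx : x ∈ D) : GK μ D x a ≤ C * (V x / V a) := by
  have hb : ∀ y ∈ D, y ∉ D \ {a} → GK μ D y a ≤ C * (V y / V a) := by
    intro y hy hyE
    have : y = a := by
      by_contra hc
      exact hyE ⟨hy, hc⟩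
    subst this
    rw [ENNReal.div_self ha0 hat, mul_one]
    exact hd.bound _ _ _
  by_cases hxa : x ∈ D \ {a}
  · have l := lemM (μ := μ) (D := D) (E := D \ {a}) Set.diff_subset a (fun y => C * (V y / V a)) (by
      intro w hw
      calc ∑' y, QK μ D w y * (C * (V y / V a)) = C * ((∑' y, QK μ D w y * V y) / V a) := by
            rw [div_eq_mul_inv, ← ENNReal.tsum_mul_right, ← ENNReal.tsum_mul_left]
            refine tsum_congr fun y => ?_
            rw [div_eq_mul_inv]; ring
        _ ≤ C * ((∑' y, PK μ w y * V y) / V a) := by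
            gcongr with y
            exact QK_le D w y
        _ = _ := by rw [h w hw.1]) hb x hx
    have hz : GK μ (D \ {a}) x a = 0 := by
      unfold GK
      rw [ENNReal.tsum_eq_zero]
      intro n
      by_contra hc
      have := (kpow_QK_mem hc).1 hxa
      exact this.2 rfl
    rwa [hz, add_zero] at l
  · exact hb x hx hxa

end FinalPart
theorem harnack_at_infinity
    (Γ : Type) [Group Γ] (S : Set Γ) (δ : ℝ)
    (hS : IsGenSet S) (hδ : IsHyperbolic S δ) (hne : Nonelementary Γ)
    (μ : Γ → ℝ) (hμ : IsRWMeasure S μ) :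
    ∃ R : ℕ, 0 < R ∧ ∃ Bc : ℝ, 1 ≤ Bc ∧
      ∀ (m k : ℕ), k + 1 ≤ m → ∀ p : Γ, wl S p = 3 * R * m →
        ∀ α : ℕ → Γ, IsGeodesicSeg S p 1 α →
          ∀ u v : Γ → ℝ,
            (∀ g ∈ Cset S p ((3 * R * k : ℕ) : ℝ), 0 < u g) →
            HarmonicOn μ u (Cset S p ((3 * R * k : ℕ) : ℝ)) →
            VanishesAtInftyOn S u (Cset S p ((3 * R * k : ℕ) : ℝ)) →
            (∀ g ∈ Cset S p ((3 * R * k : ℕ) : ℝ), 0 < v g) →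
            HarmonicOn μ v (Cset S p ((3 * R * k : ℕ) : ℝ)) →
            VanishesAtInftyOn S v (Cset S p ((3 * R * k : ℕ) : ℝ)) →
            ∀ g ∈ Cset S p ((3 * R * (k + 1) : ℕ) : ℝ),
              u g / u (α (3 * R * k + 2 * R)) ≤ Bc * (v g / v (α (3 * R * k + 2 * R))) := by
  obtain ⟨d, hd1, hδ'⟩ := hyp_nat hδ
  obtain ⟨ρ, C1, hdec⟩ := decay_exists hS hne hδ' hμ
  obtain ⟨κ, hκ0, hκh, hκ⟩ := kappa_exists hS hμ
  have hκ1 : κ ≤ 1 := hκh.trans (by simp)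
  obtain ⟨W, L, w1, w2, w3⟩ := words_exist hS hμ
  obtain ⟨C, hC, hanc⟩ := ancona hS hμ hd1 hδ' hdec (κ := κ ^ (L * L + L))
    (pos_iff_ne_zero.2 (pow_ne_zero _ hκ0.ne')) (pow_le_one' hκ1 _) (6 * d + 1)
  refine ⟨6 * d + 2 * L + 10, by omega, max 1 (C * C1).toReal, le_max_left _ _, ?_⟩
  obtain ⟨R, hR⟩ : ∃ R, R = 6 * d + 2 * L + 10 := ⟨_, rfl⟩
  rw [← hR]
  intro m k hkm p hp α hα u v hu1 hu2 hu3 hv1 hv2 hv3 g hg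
  obtain ⟨r0, hr0⟩ : ∃ r0, r0 = 3 * R * k := ⟨_, rfl⟩
  have hm : r0 + 3 * R ≤ 3 * R * m := by
    rw [hr0]; nlinarith
  have hg0 : 3 * R * (k + 1) = r0 + 3 * R := by rw [hr0]; ring
  rw [hg0] at hg
  rw [← hr0] at hu1 hu2 hu3 hv1 hv2 hv3 ⊢
  obtain ⟨a, ha⟩ : ∃ a, a = α (r0 + 2 * R) := ⟨_, rfl⟩
  rw [← ha]
  have hlen : wdist S p 1 = 3 * R * m := by rw [wd_one' hS, hp]
  have hap : wdist S a p = r0 + 2 * R := by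
    have := hα.2.2 0 (r0 + 2 * R) (by omega) (by omega)
    rw [hα.1, ← ha, wd_comm hS] at this
    rw [this, Nat.dist_eq_sub_of_le (by omega)]; omega
  have ha1 : wdist S a 1 = 3 * R * m - (r0 + 2 * R) := by
    have := hα.2.2 (r0 + 2 * R) (wdist S p 1) (by omega) le_rfl
    rw [hα.2.1, ← ha] at this
    rw [this, hlen, Nat.dist_eq_sub_of_le (by omega)]
  have hleva : gp S p a 1 = r0 + 2 * R := by
    unfold gp
    rw [hap, ha1, wd_comm hS 1 p, hlen, Nat.cast_sub (by omega)]
    push_cast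
    ring
  have hRr : (R : ℝ) = 6 * d + 2 * L + 10 := by rw [hR]; push_cast; ring
  have hd0 : (1 : ℝ) ≤ d := by exact_mod_cast hd1
  have hL0 : (0 : ℝ) ≤ L := by positivity
  have hg' : (r0 : ℝ) + 3 * R < gp S p g 1 := by
    have : ((r0 + 3 * R : ℕ) : ℝ) < gp S p g 1 := hg
    push_cast at this
    exact this
  obtain ⟨l, hl⟩ : ∃ l : ℝ, l = r0 + 4 * d + 2 * L + 1 := ⟨_, rfl⟩
  have haC : a ∈ Cset S p l := by
    change l < gp S p a 1
    rw [hleva]; linarith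
  have hgC : g ∈ Cset S p l := by
    change l < gp S p g 1
    linarith
  obtain ⟨D, hD⟩ : ∃ D, D = DS S W p a l := ⟨_, rfl⟩
  obtain ⟨Dp, hDp⟩ : ∃ Dp, Dp = Cset S p ((r0 : ℝ) + 1) := ⟨_, rfl⟩
  have hDpe : Dp = Cset S p (l - 4 * d - 2 * L) := by
    rw [hDp]; congr 1; linarith
  have hDD : D ⊆ Dp := by
    intro y hy
    rw [hD] at hy
    have h : l - 2 * d - L < gp S p y 1 := DS_lev hS hμ hδ' w1 w3 haC hy
    rw [hDp]
    change (r0 : ℝ) + 1 < gp S p y 1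
    linarith
  have hnb : ∀ x ∈ Dp, ∀ y, wdist S x y ≤ 1 → y ∈ Cset S p (r0 : ℝ) := by
    intro x hx y hxy
    rw [hDp] at hx
    have := near_lev hS (L := 1) hx hxy
    convert this using 2
    push_cast; ring
  have hDC : D ⊆ Cset S p (r0 : ℝ) := fun x hx => hnb x (hDD hx) x (by rw [wd_self]; omega)
  have hCD : Cset S p l ⊆ D := by rw [hD]; exact Cset_sub_DS
  have haD := hCD haC
  have hgD := hCD hgC
  have ua := hu1 a (hDC haD)
  have va := hv1 a (hDC haD)
  have ug := hu1 g (hDC hgD)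
  have vg := hv1 g (hDC hgD)
  have hU : ∀ x ∈ Dp, ∑' h, PK μ x h * ENNReal.ofReal (u h) = ENNReal.ofReal (u x) :=
    fun x hx => harm_PK hS hμ hu1 hu2 (hnb x hx)
  have hV : ∀ x ∈ Dp, ∑' h, PK μ x h * ENNReal.ofReal (v h) = ENNReal.ofReal (v x) :=
    fun x hx => harm_PK hS hμ hv1 hv2 (hnb x hx)
  have hUD := fun x hx => hU x (hDD hx)
  have hout : ∀ z ∈ D, (κ ^ (L * L + L)) ^ (wdist S a z + 1) ≤ GK μ D a z := by
    intro z hz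
    rw [hD] at hz ⊢
    exact DS_out hS hμ w1 w2 w3 hκ1 hκ p a l z hz
  have hin : ∀ x ∈ D, (κ ^ (L * L + L)) ^ (wdist S x a + 1) ≤ GK μ Dp x a := by
    intro x hx
    rw [hD] at hx
    rw [hDpe]
    exact DS_in hS hμ hδ' w1 w2 w3 hκ1 hκ p a l haC x hx
  -- pointwise Ancona bound
  have hpt : ∀ z, GK μ D g z * flux μ D (fun h => ENNReal.ofReal (u h)) z
      ≤ C * GK μ Dp g a * (GK μ D a z * flux μ D (fun h => ENNReal.ofReal (u h)) z) := by
    intro z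
    by_cases hf : GK μ D g z * flux μ D (fun h => ENNReal.ofReal (u h)) z = 0
    · rw [hf]; exact zero_le
    have hzD : z ∈ D := by
      have h1 := left_ne_zero_of_mul hf
      unfold GK at h1
      simp only [ne_eq, ENNReal.tsum_eq_zero, not_forall] at h1
      obtain ⟨n, hn⟩ := h1
      exact (kpow_QK_mem hn).1 hgD
    have hlz : gp S p z 1 ≤ l + 1 := by
      have h1 := right_ne_zero_of_mul hf
      unfold flux at h1
      simp only [ne_eq, ENNReal.tsum_eq_zero, not_forall] at h1
      obtain ⟨h, hh⟩ := h1
      have h2 := left_ne_zero_of_mul hh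
      by_cases hhD : h ∈ D
      · simp [hhD] at h2
      · rw [if_neg hhD] at h2
        have h3 := PK_near hS hμ h2
        have h4 : gp S p h 1 ≤ l := by
          by_contra hc
          exact hhD (hCD (not_le.1 hc))
        have h5 := gp_lip hS p z h 1
        have h6 : (wdist S z h : ℝ) ≤ 1 := by exact_mod_cast h3
        linarith
    have hgz : gp S p g z ≤ l + 1 + d := by
      rcases hyp4 hδ' hS p z 1 g with h | h
      · rw [gp_comm hS p z g] at h; linarith
      · linarith
    have hga : (r0 : ℝ) + 2 * R - d ≤ gp S p g a := by
      rcases hyp4 hδ' hS p g a 1 with h | h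
      · linarith
      · rw [gp_comm hS p 1 a] at h; linarith
    have hza : gp S p g z - d ≤ gp S p z a := by
      rcases hyp4 hδ' hS p z a g with h | h
      · rw [gp_comm hS p z g] at h; exact h
      · linarith
    have hgp : gp S a g z ≤ 2 * d := by
      rw [gp_change p a g z hS, hap]
      push_cast
      linarith
    obtain ⟨γ, g0, gn, hγ⟩ := geod_exists hS g z
    obtain ⟨t, ht, hta⟩ := near_point hS hδ' a g z hgp g0 gn rfl hγ
    have := hanc D Dp a hDD hout hin γ _ t hγ ht hta g z g0 gn hgD hzD
    calc GK μ D g z * flux μ D (fun h => ENNReal.ofReal (u h)) z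
        ≤ (C * (GK μ Dp g a * GK μ D a z)) * flux μ D (fun h => ENNReal.ofReal (u h)) z := by
          gcongr
      _ = _ := by ring
  have hvan : ∀ ε : ℝ≥0∞, 0 < ε → ε ≠ ⊤ →
      ∃ M : ℕ, ∀ g ∈ D, M ≤ wl S g → ENNReal.ofReal (u g) ≤ ε := by
    intro ε h0 ht
    obtain ⟨M, hM⟩ := hu3 ε.toReal (ENNReal.toReal_pos h0.ne' ht)
    refine ⟨M, fun y hy hyM => ?_⟩
    exact ENNReal.ofReal_le_of_le_toReal ((le_abs_self _).trans (hM y (hDC hy) hyM))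
  have e1 := repr_le hS hμ hdec (U := fun h => ENNReal.ofReal (u h))
    (fun x => ENNReal.ofReal_ne_top) hUD hvan hgD
  have e2 := repr_ge (U := fun h => ENNReal.ofReal (u h)) hUD haD
  have e3 := GK_le_harm hdec (V := fun h => ENNReal.ofReal (v h)) hV (a := a)
    (by simpa using va) ENNReal.ofReal_ne_top (hDD hgD)
  have e4 : ENNReal.ofReal (u g)
      ≤ C * (C1 * (ENNReal.ofReal (v g) / ENNReal.ofReal (v a))) * ENNReal.ofReal (u a) := by
    calc ENNReal.ofReal (u g) ≤ _ := e1
      _ ≤ ∑' z, C * GK μ Dp g a * (GK μ D a z * flux μ D (fun h => ENNReal.ofReal (u h)) z) :=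
        ENNReal.tsum_le_tsum hpt
      _ = C * GK μ Dp g a * ∑' z, GK μ D a z * flux μ D (fun h => ENNReal.ofReal (u h)) z :=
        ENNReal.tsum_mul_left
      _ ≤ _ := by gcongr
  rw [← ENNReal.ofReal_div_of_pos va] at e4
  have hfin : C * (C1 * ENNReal.ofReal (v g / v a)) * ENNReal.ofReal (u a) ≠ ⊤ :=
    ENNReal.mul_ne_top (ENNReal.mul_ne_top hC (ENNReal.mul_ne_top hdec.ctop ENNReal.ofReal_ne_top))
      ENNReal.ofReal_ne_top
  have e5 := ENNReal.toReal_mono hfin e4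
  have hq : 0 ≤ v g / v a := (div_pos vg va).le
  simp only [ENNReal.toReal_mul, ENNReal.toReal_ofReal ug.le, ENNReal.toReal_ofReal ua.le,
    ENNReal.toReal_ofReal hq] at e5
  rw [div_le_iff₀ ua]
  calc u g ≤ _ := e5
    _ = (C * C1).toReal * (v g / v a) * u a := by rw [ENNReal.toReal_mul]; ring
    _ ≤ _ := by gcongr; exact le_max_right _ _

end HarmonicBoundary
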